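/- arXiv:2605.14302 — 12 statements merged into one kernel-verified Lean document; each statement's English description precedes it below -/
import Mathlib

section
/- Let a, b ≥ 0 and c > 0 satisfy 2c(a+b) ≤ a² + b². Suppose G : ℝ → ℝ is differentiable on [0,1] with G(0) = 0, G(1) = c, G'(0) = a, G'(1) = b, G'(t) ≥ 0 for all t ∈ [0,1], and G' is Lipschitz on [0,1] with constant M ≥ 0. Then M ≥ (a² + b²)/(2c). -/
/-- A function on `[0, 1]` with nonnegative one-sided derivatives is monotone there. -/
lemma monotoneOn_unit_of_hasDerivWithinAt_nonneg {F f : ℝ → ℝ}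
    (hF : ∀ t ∈ Set.Icc (0:ℝ) 1, HasDerivWithinAt F (f t) (Set.Icc (0:ℝ) 1) t)
    (hf : ∀ t ∈ Set.Icc (0:ℝ) 1, 0 ≤ f t) : MonotoneOn F (Set.Icc (0:ℝ) 1) :=
  monotoneOn_of_hasDerivWithinAt_nonneg (convex_Icc 0 1)
    (fun t ht => (hF t ht).continuousWithinAt)
    (fun t ht => (hF t (interior_subset ht)).mono interior_subset)
    (fun t ht => hf t (interior_subset ht))


/-- Lower bound for the curvature in the regime `2c(a+b) ≤ a² + b²`:
any monotone Hermite interpolant with `M`-Lipschitz derivative satisfies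
`M ≥ (a² + b²)/(2c)`. -/
theorem curvature_lower_bound_small_c
    (a b c M : ℝ) (ha : 0 ≤ a) (hb : 0 ≤ b) (hc : 0 < c)
    (hreg : 2 * c * (a + b) ≤ a ^ 2 + b ^ 2) (hM : 0 ≤ M)
    (G g : ℝ → ℝ)
    (hderiv : ∀ t ∈ Set.Icc (0:ℝ) 1, HasDerivWithinAt G (g t) (Set.Icc (0:ℝ) 1) t)
    (hG0 : G 0 = 0) (hG1 : G 1 = c) (hg0 : g 0 = a) (hg1 : g 1 = b)
    (hpos : ∀ t ∈ Set.Icc (0:ℝ) 1, 0 ≤ g t)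
    (hlip : ∀ s ∈ Set.Icc (0:ℝ) 1, ∀ t ∈ Set.Icc (0:ℝ) 1, |g s - g t| ≤ M * |s - t|) :
    (a ^ 2 + b ^ 2) / (2 * c) ≤ M := by
  have h0 : (0:ℝ) ∈ Set.Icc (0:ℝ) 1 := by simp
  have h1 : (1:ℝ) ∈ Set.Icc (0:ℝ) 1 := by simp
  set K := (a ^ 2 + b ^ 2) / (2 * c) with hK
  have hKc : 2 * c * K = a ^ 2 + b ^ 2 := by rw [hK]; field_simp
  have hK0 : 0 ≤ K := by positivity
  rcases hK0.eq_or_lt with hKz | hKpos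
  · rwa [← hKz]
  have hab : a + b ≤ K := by
    rw [hK, le_div_iff₀ (by positivity)]
    linarith
  have hleft : MonotoneOn (fun t => G t - a * t + M / 2 * t ^ 2) (Set.Icc (0:ℝ) 1) := by
    refine monotoneOn_unit_of_hasDerivWithinAt_nonneg (f := fun t => g t - a + M * t) ?_ ?_
    · intro t ht
      exact (((hderiv t ht).sub ((hasDerivWithinAt_id t _).const_mul a)).add
        (((hasDerivWithinAt_id t _).pow 2).const_mul (M / 2))).congr_deriv
          (by simp only [id_eq]; norm_num; ring)
    · intro t ht
      have h := (abs_le.mp (hlip t ht 0 h0)).1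
      rw [hg0, sub_zero, abs_of_nonneg ht.1] at h
      linarith
  have hright : MonotoneOn (fun t => G t - b * t - M / 2 * (1 - t) ^ 2) (Set.Icc (0:ℝ) 1) := by
    refine monotoneOn_unit_of_hasDerivWithinAt_nonneg
      (f := fun t => g t - b + M * (1 - t)) ?_ ?_
    · intro t ht
      exact (((hderiv t ht).sub ((hasDerivWithinAt_id t _).const_mul b)).sub
        ((((hasDerivWithinAt_id t _).const_sub 1).pow 2).const_mul (M / 2))).congr_deriv
          (by simp only [id_eq]; norm_num; ring)
    · intro t ht
      have h := (abs_le.mp (hlip t ht 1 h1)).1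
      rw [hg1, abs_sub_comm t 1, abs_of_nonneg (sub_nonneg.mpr ht.2)] at h
      linarith
  have hmono := monotoneOn_unit_of_hasDerivWithinAt_nonneg hderiv hpos
  obtain ⟨p, hp⟩ : ∃ p, p = a / K := ⟨_, rfl⟩
  obtain ⟨q, hq⟩ : ∃ q, q = b / K := ⟨_, rfl⟩
  have hp0 : 0 ≤ p := hp ▸ by positivity
  have hq0 : 0 ≤ q := hq ▸ by positivity
  have hpq : p + q ≤ 1 := by
    rw [hp, hq, ← add_div, div_le_one hKpos]
    exact hab
  have hap : a = K * p := by rw [hp]; field_simp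
  have hbq : b = K * q := by rw [hq]; field_simp
  have hpI : p ∈ Set.Icc (0:ℝ) 1 := ⟨hp0, by linarith⟩
  have hqI : 1 - q ∈ Set.Icc (0:ℝ) 1 := ⟨by linarith, by linarith⟩
  have e1 := hleft h0 hpI hp0
  have e2 := hmono hpI hqI (by linarith)
  have e3 := hright hqI h1 hqI.2
  simp only [hG0, hG1] at e1 e3
  rw [hap] at e1
  rw [hbq] at e3
  have hcpq : 2 * c = K * (p ^ 2 + q ^ 2) := by
    rw [hap, hbq] at hKc
    exact mul_right_cancel₀ hKpos.ne' (by linarith)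
  have hpos' : 0 < p ^ 2 + q ^ 2 := by
    by_contra! h
    nlinarith
  refine le_of_mul_le_mul_right ?_ hpos'
  linarith
end

section
/- Let a, b ≥ 0 and c > 0 satisfy a² + b² ≤ 2c(a+b) and 2c ≤ a + b. Suppose G : ℝ → ℝ is differentiable on [0,1] with G(0) = 0, G(1) = c, G'(0) = a, G'(1) = b, G'(t) ≥ 0 for all t ∈ [0,1], and G' is Lipschitz on [0,1] with constant M ≥ 0. Then M ≥ (a + b − 2c) + √((a + b − 2c)² + (b − a)²). -/
/-- A function whose derivative on `[0, 1]` dominates the affine function `p + q * t` grows at least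
as fast as its primitive. -/
theorem le_sub_of_affine_le_deriv {G g : ℝ → ℝ} {p q x y : ℝ}
    (hderiv : ∀ t ∈ Set.Icc (0:ℝ) 1, HasDerivWithinAt G (g t) (Set.Icc (0:ℝ) 1) t)
    (hle : ∀ t ∈ Set.Icc (0:ℝ) 1, p + q * t ≤ g t)
    (hx : x ∈ Set.Icc (0:ℝ) 1) (hy : y ∈ Set.Icc (0:ℝ) 1) (hxy : x ≤ y) :
    p * (y - x) + q / 2 * (y ^ 2 - x ^ 2) ≤ G y - G x := by
  have hF : ∀ t ∈ Set.Icc (0:ℝ) 1, HasDerivWithinAt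
      (fun t => G t - (p * t + q / 2 * t ^ 2)) (g t - (p + q * t)) (Set.Icc (0:ℝ) 1) t := by
    intro t ht
    have hpoly : HasDerivAt (fun t : ℝ => p * t + q / 2 * t ^ 2) (p + q * t) t := by
      have h := ((hasDerivAt_id t).const_mul p).add (((hasDerivAt_id t).pow 2).const_mul (q / 2))
      refine (h.congr_deriv ?_).congr_of_eventuallyEq (Filter.Eventually.of_forall fun _ => rfl)
      simp
      ring
    exact (hderiv t ht).sub hpoly.hasDerivWithinAt
  have hmono := monotoneOn_of_hasDerivWithinAt_nonneg (convex_Icc (0:ℝ) 1)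
    (fun t ht => (hF t ht).continuousWithinAt)
    (fun t ht => (hF t (interior_subset ht)).mono interior_subset)
    (fun t ht => sub_nonneg.2 (hle t (interior_subset ht)))
  have h := hmono hx hy hxy
  dsimp only at h
  linarith

/-- Lower bound for the curvature in the regime `a² + b² ≤ 2c(a+b)` and `2c ≤ a + b`:
any monotone Hermite interpolant with `M`-Lipschitz derivative satisfies
`M ≥ (a + b − 2c) + √((a + b − 2c)² + (b − a)²)`. -/
theorem curvature_lower_bound_middle_c
    (a b c M : ℝ) (ha : 0 ≤ a) (hb : 0 ≤ b) (hc : 0 < c)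
    (hreg : a ^ 2 + b ^ 2 ≤ 2 * c * (a + b)) (hreg' : 2 * c ≤ a + b) (hM : 0 ≤ M)
    (G g : ℝ → ℝ)
    (hderiv : ∀ t ∈ Set.Icc (0:ℝ) 1, HasDerivWithinAt G (g t) (Set.Icc (0:ℝ) 1) t)
    (hG0 : G 0 = 0) (hG1 : G 1 = c) (hg0 : g 0 = a) (hg1 : g 1 = b)
    (hpos : ∀ t ∈ Set.Icc (0:ℝ) 1, 0 ≤ g t)
    (hlip : ∀ s ∈ Set.Icc (0:ℝ) 1, ∀ t ∈ Set.Icc (0:ℝ) 1, |g s - g t| ≤ M * |s - t|) :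
    (a + b - 2 * c) + Real.sqrt ((a + b - 2 * c) ^ 2 + (b - a) ^ 2) ≤ M := by
  have h0 : (0:ℝ) ∈ Set.Icc (0:ℝ) 1 := by simp
  have h1 : (1:ℝ) ∈ Set.Icc (0:ℝ) 1 := by simp
  have hleft : ∀ t ∈ Set.Icc (0:ℝ) 1, a + -M * t ≤ g t := by
    intro t ht
    have h := hlip 0 h0 t ht
    rw [hg0, zero_sub, abs_neg, abs_of_nonneg ht.1] at h
    linarith [le_abs_self (a - g t)]
  have hright : ∀ t ∈ Set.Icc (0:ℝ) 1, (b - M) + M * t ≤ g t := by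
    intro t ht
    have h := hlip 1 h1 t ht
    rw [hg1, abs_of_nonneg (sub_nonneg.2 ht.2)] at h
    linarith [le_abs_self (b - g t)]
  have hbound : ∀ t ∈ Set.Icc (0:ℝ) 1,
      a * t - M / 2 * t ^ 2 + b * (1 - t) - M / 2 * (1 - t) ^ 2 ≤ c := by
    intro t ht
    have hl := le_sub_of_affine_le_deriv hderiv hleft h0 ht ht.1
    have hr := le_sub_of_affine_le_deriv hderiv hright ht h1 ht.2
    rw [hG0] at hl
    rw [hG1] at hr
    linarith
  have hab : |a - b| ≤ M := by simpa [hg0, hg1] using hlip 0 h0 1 h1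
  obtain ⟨hab₁, hab₂⟩ := abs_le.1 hab
  have hquad : (b - a) ^ 2 ≤ M * (M - 2 * (a + b - 2 * c)) := by
    rcases hM.eq_or_lt with rfl | hMpos
    · have : b = a := by linarith
      simp [this]
    · have ht : (M + a - b) / (2 * M) ∈ Set.Icc (0:ℝ) 1 :=
        ⟨div_nonneg (by linarith) (by linarith), (div_le_one (by linarith)).2 (by linarith)⟩
      have h := mul_le_mul_of_nonneg_left (hbound _ ht) (by linarith : 0 ≤ 4 * M)
      have hval : 4 * M * (a * ((M + a - b) / (2 * M)) - M / 2 * ((M + a - b) / (2 * M)) ^ 2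
          + b * (1 - (M + a - b) / (2 * M)) - M / 2 * (1 - (M + a - b) / (2 * M)) ^ 2)
          = 2 * M * (a + b) - M ^ 2 + (b - a) ^ 2 := by
        field_simp
        ring
      rw [hval] at h
      linarith
  have hSM : a + b - 2 * c ≤ M := by
    have := hbound 0 h0
    have := hbound 1 h1
    linarith
  have hsqrt : Real.sqrt ((a + b - 2 * c) ^ 2 + (b - a) ^ 2) ≤ M - (a + b - 2 * c) :=
    Real.sqrt_le_iff.2 ⟨sub_nonneg.2 hSM, by linarith⟩
  linarith
end

section
/- Let a, b, c ≥ 0 satisfy 2c ≥ a + b. Suppose G : ℝ → ℝ is differentiable on [0,1] with G(0) = 0, G(1) = c, G'(0) = a, G'(1) = b, G'(t) ≥ 0 for all t ∈ [0,1], and G' is Lipschitz on [0,1] with constant M ≥ 0. Then M ≥ (2c − a − b) + √((2c − a − b)² + (b − a)²). -/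
theorem monotoneOn_Icc_of_hasDerivWithinAt_nonneg {f : ℝ → ℝ} (f' : ℝ → ℝ) {x y : ℝ}
    (hf : ∀ t ∈ Set.Icc x y, HasDerivWithinAt f (f' t) (Set.Icc x y) t)
    (hf' : ∀ t ∈ Set.Icc x y, 0 ≤ f' t) : MonotoneOn f (Set.Icc x y) :=
  monotoneOn_of_hasDerivWithinAt_nonneg (convex_Icc x y)
    (fun t ht => (hf t ht).continuousWithinAt)
    (fun t ht => (hf t (interior_subset ht)).mono interior_subset)
    (fun t ht => hf' t (interior_subset ht))


/-- Lower bound for the curvature in the regime `2c ≥ a + b`: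
any monotone Hermite interpolant with `M`-Lipschitz derivative satisfies
`M ≥ (2c − a − b) + √((2c − a − b)² + (b − a)²)`. -/
theorem curvature_lower_bound_large_c
    (a b c M : ℝ) (ha : 0 ≤ a) (hb : 0 ≤ b) (hc : 0 ≤ c)
    (hreg : a + b ≤ 2 * c) (hM : 0 ≤ M)
    (G g : ℝ → ℝ)
    (hderiv : ∀ t ∈ Set.Icc (0:ℝ) 1, HasDerivWithinAt G (g t) (Set.Icc (0:ℝ) 1) t)
    (hG0 : G 0 = 0) (hG1 : G 1 = c) (hg0 : g 0 = a) (hg1 : g 1 = b)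
    (hpos : ∀ t ∈ Set.Icc (0:ℝ) 1, 0 ≤ g t)
    (hlip : ∀ s ∈ Set.Icc (0:ℝ) 1, ∀ t ∈ Set.Icc (0:ℝ) 1, |g s - g t| ≤ M * |s - t|) :
    (2 * c - a - b) + Real.sqrt ((2 * c - a - b) ^ 2 + (b - a) ^ 2) ≤ M := by
  have mem0 : (0:ℝ) ∈ Set.Icc (0:ℝ) 1 := by simp
  have mem1 : (1:ℝ) ∈ Set.Icc (0:ℝ) 1 := by simp
  have left_bound : ∀ t ∈ Set.Icc (0:ℝ) 1, G t ≤ a * t + M * t ^ 2 / 2 := by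
    have hmono : MonotoneOn (fun t => a * t + M * t ^ 2 / 2 - G t) (Set.Icc (0:ℝ) 1) := by
      refine monotoneOn_Icc_of_hasDerivWithinAt_nonneg (fun t => a + M * t - g t) ?_ ?_
      · intro t ht
        have h1 : HasDerivAt (fun t : ℝ => a * t + M * t ^ 2 / 2) (a + M * t) t := by
          refine HasDerivAt.congr_deriv (((hasDerivAt_id' t).const_mul a).add
            ((((hasDerivAt_id' t).pow 2).const_mul M).div_const 2)) ?_
          norm_num
          ring
        exact h1.hasDerivWithinAt.sub (hderiv t ht)
      · intro t ht
        have h := hlip t ht 0 mem0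
        rw [hg0, sub_zero, abs_of_nonneg ht.1] at h
        linarith [le_abs_self (g t - a)]
    intro t ht
    have h := hmono mem0 ht ht.1
    simp only [hG0] at h
    linarith
  have right_bound : ∀ t ∈ Set.Icc (0:ℝ) 1,
      c - G t ≤ b * (1 - t) + M * (1 - t) ^ 2 / 2 := by
    have hmono : MonotoneOn (fun t => b * t - M * (1 - t) ^ 2 / 2 - G t)
        (Set.Icc (0:ℝ) 1) := by
      refine monotoneOn_Icc_of_hasDerivWithinAt_nonneg (fun t => b + M * (1 - t) - g t) ?_ ?_
      · intro t ht
        have h1 : HasDerivAt (fun t : ℝ => b * t - M * (1 - t) ^ 2 / 2)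
            (b + M * (1 - t)) t := by
          refine HasDerivAt.congr_deriv (((hasDerivAt_id' t).const_mul b).sub
            (((((hasDerivAt_id' t).const_sub 1).pow 2).const_mul M).div_const 2)) ?_
          norm_num
          ring
        exact h1.hasDerivWithinAt.sub (hderiv t ht)
      · intro t ht
        have h := hlip t ht 1 mem1
        rw [hg1, abs_sub_comm t, abs_of_nonneg (sub_nonneg.2 ht.2)] at h
        linarith [le_abs_self (g t - b)]
    intro t ht
    have h := hmono ht mem1 ht.2
    simp only [hG1] at h
    linarith
  have hd : |b - a| ≤ M := by
    simpa [hg0, hg1] using hlip 1 mem1 0 mem0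
  obtain ⟨hd1, hd2⟩ := abs_le.1 hd
  rcases hM.eq_or_lt with rfl | hMpos
  · have hab : b = a := by linarith
    have h := left_bound 1 mem1
    have hE : 2 * c - a - b = 0 := by linarith
    rw [hE, hab]; simp
  · have hτ : (M + (b - a)) / (2 * M) ∈ Set.Icc (0:ℝ) 1 :=
      ⟨by apply div_nonneg <;> linarith, by rw [div_le_one (by linarith)]; linarith⟩
    have h := add_le_add (left_bound _ hτ) (right_bound _ hτ)
    have key : 2 * M * (2 * c - a - b) ≤ M ^ 2 - (b - a) ^ 2 := by
      have hsum : 2 * c - a - b ≤ (M ^ 2 - (b - a) ^ 2) / (2 * M) := by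
        have hcalc : (M ^ 2 - (b - a) ^ 2) / (2 * M) =
            2 * (a * ((M + (b - a)) / (2 * M)) + M * ((M + (b - a)) / (2 * M)) ^ 2 / 2 +
            (b * (1 - (M + (b - a)) / (2 * M)) +
              M * (1 - (M + (b - a)) / (2 * M)) ^ 2 / 2)) - a - b := by
          field_simp
          ring
        linarith
      rw [le_div_iff₀ (by linarith)] at hsum
      linarith
    have hEM : 2 * c - a - b ≤ M := by nlinarith [sq_nonneg (b - a)]
    have hsqrt : Real.sqrt ((2 * c - a - b) ^ 2 + (b - a) ^ 2) ≤ M - (2 * c - a - b) :=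
      Real.sqrt_le_iff.2 ⟨by linarith, by nlinarith⟩
    linarith
end

section
/- Let a, b, c ≥ 0 with 2c ≥ a + b, and set M := (2c − a − b) + √((2c − a − b)² + (b − a)²). Assume M > 0 and set t₀ := 1/2 + (b − a)/(2M). Define G : ℝ → ℝ by G(t) = (M/2)t² + a t for 0 ≤ t ≤ t₀ and G(t) = −(M/2)t² + (M + b)t + (c − b − M/2) for t₀ ≤ t ≤ 1. Then G is differentiable on [0,1], G(0) = 0, G(1) = c, G'(0) = a, G'(1) = b, G'(t) ≥ 0 for all t ∈ [0,1], and G' is Lipschitz on [0,1] with constant M. -/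
/-- Gluing two functions whose values and derivatives agree at the junction point. -/
theorem hasDerivAt_ite_le {p q p' q' : ℝ → ℝ} {t₀ : ℝ}
    (hp : ∀ t, HasDerivAt p (p' t) t) (hq : ∀ t, HasDerivAt q (q' t) t)
    (h : p t₀ = q t₀) (h' : p' t₀ = q' t₀) (t : ℝ) :
    HasDerivAt (fun x => if x ≤ t₀ then p x else q x) (if t ≤ t₀ then p' t else q' t) t := by
  rcases lt_trichotomy t t₀ with ht | rfl | ht
  · rw [if_pos ht.le]
    refine (hp t).congr_of_eventuallyEq ?_
    filter_upwards [Iio_mem_nhds ht] with x hx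
    exact if_pos (le_of_lt hx)
  · rw [if_pos le_rfl, ← hasDerivWithinAt_univ, ← Set.Iic_union_Ici (a := t)]
    refine HasDerivWithinAt.union ?_ ?_
    · exact (hp t).hasDerivWithinAt.congr (fun x hx => if_pos hx) (if_pos le_rfl)
    · refine (h' ▸ (hq t).hasDerivWithinAt).congr (fun x hx => ?_) ((if_pos le_rfl).trans h)
      rcases (Set.mem_Ici.mp hx).eq_or_lt with rfl | hlt
      · exact (if_pos le_rfl).trans h
      · exact if_neg hlt.not_ge
  · rw [if_neg ht.not_ge]
    refine (hq t).congr_of_eventuallyEq ?_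
    filter_upwards [Ioi_mem_nhds ht] with x hx
    exact if_neg (not_le_of_gt hx)

/-- Explicit optimal quadratic-spline interpolant in the regime `2c ≥ a + b`. -/
theorem explicit_interpolant_large_c
    (a b c M t₀ : ℝ) (ha : 0 ≤ a) (hb : 0 ≤ b) (hc : 0 ≤ c)
    (habc : a + b ≤ 2 * c)
    (hM : M = (2 * c - a - b) + Real.sqrt ((2 * c - a - b) ^ 2 + (b - a) ^ 2))
    (hMpos : 0 < M)
    (ht₀ : t₀ = 1 / 2 + (b - a) / (2 * M))
    (G : ℝ → ℝ)
    (hGdef : ∀ t, G t = if t ≤ t₀ then M / 2 * t ^ 2 + a * t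
      else -(M / 2) * t ^ 2 + (M + b) * t + (c - b - M / 2)) :
    G 0 = 0 ∧ G 1 = c ∧
    ∃ g : ℝ → ℝ,
      (∀ t ∈ Set.Icc (0:ℝ) 1, HasDerivWithinAt G (g t) (Set.Icc (0:ℝ) 1) t) ∧
      g 0 = a ∧ g 1 = b ∧
      (∀ t ∈ Set.Icc (0:ℝ) 1, 0 ≤ g t) ∧
      (∀ s ∈ Set.Icc (0:ℝ) 1, ∀ t ∈ Set.Icc (0:ℝ) 1, |g s - g t| ≤ M * |s - t|) := by
 
  have hsq : (M - (2 * c - a - b)) ^ 2 = (2 * c - a - b) ^ 2 + (b - a) ^ 2 := by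
    rw [hM, add_sub_cancel_left, Real.sq_sqrt (by positivity)]
  have hD : 0 ≤ 2 * c - a - b := by linarith
  have habs : |b - a| ≤ M := abs_le_of_sq_le_sq (by nlinarith) hMpos.le
  obtain ⟨hba, hab⟩ := abs_le.mp habs
  have hMt : M * t₀ = (M + b - a) / 2 := by rw [ht₀]; field_simp; ring
  have hval : M / 2 * t₀ ^ 2 + a * t₀
      = -(M / 2) * t₀ ^ 2 + (M + b) * t₀ + (c - b - M / 2) := by
    apply mul_left_cancel₀ hMpos.ne'
    linear_combination (M * t₀ + (M + b - a) / 2 + (a - b - M)) * hMt + hsq / 4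
  have hp : ∀ t, HasDerivAt (fun t => M / 2 * t ^ 2 + a * t) (M * t + a) t := fun t =>
    (((hasDerivAt_pow 2 t).const_mul (M / 2)).add ((hasDerivAt_id t).const_mul a)).congr_deriv
      (by push_cast; ring)
  have hq : ∀ t, HasDerivAt (fun t => -(M / 2) * t ^ 2 + (M + b) * t + (c - b - M / 2))
      (-M * t + M + b) t := fun t =>
    ((((hasDerivAt_pow 2 t).const_mul (-(M / 2))).add
      ((hasDerivAt_id t).const_mul (M + b))).add_const (c - b - M / 2)).congr_deriv
      (by push_cast; ring)
  have hderiv := hasDerivAt_ite_le hp hq hval (by linarith)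
  have hmin : ∀ t, (if t ≤ t₀ then M * t + a else -M * t + M + b)
      = min (M * t + a) (-M * t + M + b) := fun t => by
    split_ifs with ht
    · exact (min_eq_left (by nlinarith)).symm
    · exact (min_eq_right (by nlinarith)).symm
  have h0 : 0 ≤ t₀ := by nlinarith
  have h1 : t₀ ≤ 1 := by nlinarith
  refine ⟨by rw [hGdef, if_pos h0]; ring, ?_,
    fun t => min (M * t + a) (-M * t + M + b), fun t _ => ?_, ?_, ?_, fun t ht => ?_,
    fun s _ t _ => ?_⟩
  · rw [hGdef]
    split_ifs with h
    · rw [le_antisymm h1 h] at hval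
      linarith
    · ring
  · rw [funext hGdef]
    exact (hmin t ▸ hderiv t).hasDerivWithinAt
  · exact (min_eq_left (by linarith)).trans (by ring)
  · exact (min_eq_right (by linarith)).trans (by ring)
  · exact le_min (by nlinarith [ht.1]) (by nlinarith [ht.2])
  · refine (abs_min_sub_min_le_max _ _ _ _).trans (max_le ?_ ?_)
    · rw [← abs_of_pos hMpos, ← abs_mul, abs_of_pos hMpos]
      exact le_of_eq (congrArg _ (by ring))
    · rw [← abs_of_pos hMpos, ← abs_mul, abs_of_pos hMpos, ← abs_neg]
      exact le_of_eq (congrArg _ (by ring))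
end

section
/- Let a, b, c ≥ 0 with a² + b² ≤ 2c(a+b) and 2c ≤ a + b, and set M := (a + b − 2c) + √((a + b − 2c)² + (b − a)²). Assume M > 0 and set t̃₀ := 1/2 − (b − a)/(2M). Define G : ℝ → ℝ by G(t) = −(M/2)t² + a t for 0 ≤ t ≤ t̃₀ and G(t) = (M/2)t² + (b − M)t + (c − b + M/2) for t̃₀ ≤ t ≤ 1. Then G is differentiable on [0,1], G(0) = 0, G(1) = c, G'(0) = a, G'(1) = b, G'(t) ≥ 0 for all t ∈ [0,1], and G' is Lipschitz on [0,1] with constant M. -/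
/-- The function `x ↦ x * |x|` is differentiable everywhere, with derivative `2 * |x|`. -/
lemma hasDerivAt_self_mul_abs (x : ℝ) : HasDerivAt (fun y : ℝ => y * |y|) (2 * |x|) x := by
  rcases eq_or_ne x 0 with rfl | hx
  · rw [hasDerivAt_iff_tendsto_slope]
    have h : Filter.Tendsto (fun y : ℝ => |y|) (nhdsWithin 0 {0}ᶜ) (nhds (2 * |(0 : ℝ)|)) := by
      have h' : Filter.Tendsto (fun y : ℝ => |y|) (nhds 0) (nhds |(0 : ℝ)|) :=
        continuous_abs.tendsto 0
      simpa using h'.mono_left nhdsWithin_le_nhds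
    refine h.congr' ?_
    filter_upwards [self_mem_nhdsWithin] with y hy
    have hy0 : y ≠ 0 := hy
    simp [slope_def_field, hy0]
  · refine ((hasDerivAt_id x).mul (hasDerivAt_abs hx)).congr_deriv ?_
    have h : x * (SignType.sign x : ℝ) = |x| := self_mul_sign x
    simp only [id]
    linarith


/-- Explicit optimal quadratic-spline interpolant in the regime `c₀ ≤ c ≤ (a+b)/2`. -/
theorem explicit_interpolant_middle_c
    (a b c M t₀ : ℝ) (ha : 0 ≤ a) (hb : 0 ≤ b) (hc : 0 ≤ c)
    (hreg : a ^ 2 + b ^ 2 ≤ 2 * c * (a + b)) (hreg' : 2 * c ≤ a + b)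
    (hM : M = (a + b - 2 * c) + Real.sqrt ((a + b - 2 * c) ^ 2 + (b - a) ^ 2))
    (hMpos : 0 < M)
    (ht₀ : t₀ = 1 / 2 - (b - a) / (2 * M))
    (G : ℝ → ℝ)
    (hGdef : ∀ t, G t = if t ≤ t₀ then -(M / 2) * t ^ 2 + a * t
      else M / 2 * t ^ 2 + (b - M) * t + (c - b + M / 2)) :
    G 0 = 0 ∧ G 1 = c ∧
    ∃ g : ℝ → ℝ,
      (∀ t ∈ Set.Icc (0:ℝ) 1, HasDerivWithinAt G (g t) (Set.Icc (0:ℝ) 1) t) ∧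
      g 0 = a ∧ g 1 = b ∧
      (∀ t ∈ Set.Icc (0:ℝ) 1, 0 ≤ g t) ∧
      (∀ s ∈ Set.Icc (0:ℝ) 1, ∀ t ∈ Set.Icc (0:ℝ) 1, |g s - g t| ≤ M * |s - t|) := by
  set d := a + b - 2 * c with hd
  have hd0 : 0 ≤ d := by linarith
  have hrad : 0 ≤ d ^ 2 + (b - a) ^ 2 := by positivity
  have hsq : M ^ 2 = 2 * d * M + (b - a) ^ 2 := by
    have h := Real.sq_sqrt hrad
    rw [show √(d ^ 2 + (b - a) ^ 2) = M - d by linarith] at h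
    linarith
  have hle : M ≤ a + b := by
    have h : √(d ^ 2 + (b - a) ^ 2) ≤ 2 * c :=
      Real.sqrt_le_iff.2 ⟨by linarith, by rw [hd]; linarith⟩
    linarith
  have habs : |b - a| ≤ M := by
    refine abs_le_of_sq_le_sq ?_ hMpos.le
    nlinarith [mul_nonneg hd0 hMpos.le]
  have hMt : M * t₀ = (M - (b - a)) / 2 := by
    rw [ht₀]
    field_simp
  obtain ⟨h₁, h₂⟩ := abs_le.1 habs
  have ht0 : 0 ≤ t₀ := by
    by_contra! h
    nlinarith
  have ht1 : t₀ ≤ 1 := by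
    by_contra! h
    nlinarith
  have hconst : M * t₀ ^ 2 = c - b + M / 2 := by
    apply mul_left_cancel₀ hMpos.ne'
    calc M * (M * t₀ ^ 2) = (M * t₀) ^ 2 := by ring
      _ = M * (c - b + M / 2) := by
        rw [hMt]
        linear_combination (-1 / 4) * hsq - (M / 2) * hd
  have hG : G = fun t => (a + b - M) / 2 * t + M / 2 * ((t - t₀) * |t - t₀|) + M / 2 * t₀ ^ 2 := by
    funext t
    rw [hGdef]
    split_ifs with h
    · rw [abs_of_nonpos (by linarith)]
      linear_combination -t * hMt
    · rw [abs_of_pos (by linarith)]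
      linear_combination t * hMt - hconst
  refine ⟨?_, ?_, fun t => (a + b - M) / 2 + M * |t - t₀|, ?_, ?_, ?_, ?_, ?_⟩
  · simp [hGdef, ht0]
  · rw [hG]
    dsimp only
    rw [abs_of_nonneg (by linarith)]
    linear_combination hconst - hMt
  · intro t _
    rw [hG]
    have h := (hasDerivAt_self_mul_abs (t - t₀)).comp_sub_const t t₀
    refine HasDerivAt.hasDerivWithinAt ?_
    refine ((((hasDerivAt_id t).const_mul ((a + b - M) / 2)).add
      (h.const_mul (M / 2))).add_const (M / 2 * t₀ ^ 2)).congr_deriv ?_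
    ring
  · dsimp only
    rw [abs_of_nonpos (by linarith)]
    linear_combination hMt
  · dsimp only
    rw [abs_of_nonneg (by linarith)]
    linear_combination -hMt
  · intro t _
    have := mul_nonneg hMpos.le (abs_nonneg (t - t₀))
    dsimp only
    linarith
  · intro s _ t _
    have h := abs_abs_sub_abs_le_abs_sub (s - t₀) (t - t₀)
    rw [sub_sub_sub_cancel_right] at h
    rw [add_sub_add_left_eq_sub, ← mul_sub, abs_mul, abs_of_pos hMpos]
    exact mul_le_mul_of_nonneg_left h hMpos.le
end

section
/- Let a, b ≥ 0 and c > 0 satisfy 2c(a+b) < a² + b², and set M := (a² + b²)/(2c), τ₁ := a/M, τ₂ := 1 − b/M. Define G : ℝ → ℝ by G(t) = −(M/2)t² + a t for 0 ≤ t ≤ τ₁, G(t) = a²/(2M) for τ₁ ≤ t ≤ τ₂, and G(t) = (M/2)(t−1)² + b(t−1) + (a² + b²)/(2M) for τ₂ ≤ t ≤ 1. Then G is differentiable on [0,1], G(0) = 0, G(1) = c, G'(0) = a, G'(1) = b, G'(t) ≥ 0 for all t ∈ [0,1], and G' is Lipschitz on [0,1] with constant M. -/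
/-- The squared positive part is differentiable, with derivative twice the positive part. -/
theorem hasDerivAt_max_zero_sq (x : ℝ) :
    HasDerivAt (fun y : ℝ => max y 0 ^ 2) (2 * max x 0) x := by
  rw [hasDerivAt_iff_isLittleO]
  have hO : (fun y : ℝ => max y 0 ^ 2 - max x 0 ^ 2 - (y - x) • (2 * max x 0))
      =O[nhds x] fun y => ‖y - x‖ ^ 2 := by
    refine Asymptotics.IsBigO.of_bound 1 (Filter.Eventually.of_forall fun y => ?_)
    rw [one_mul, norm_pow, norm_norm, Real.norm_eq_abs, Real.norm_eq_abs, sq_abs, abs_le,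
      smul_eq_mul]
    rcases le_total y 0 with hy | hy <;> rcases le_total x 0 with hx | hx <;>
      simp only [hy, hx, max_eq_left, max_eq_right] <;> constructor <;>
      nlinarith [sq_nonneg (y - x), sq_nonneg x, sq_nonneg y,
        mul_nonneg (sub_nonneg.2 hy) (sub_nonneg.2 hx)]
  exact hO.trans_isLittleO (Asymptotics.isLittleO_pow_sub_sub x one_lt_two)

/-- The positive part is monotone and 1-Lipschitz, in one-sided form. -/
theorem max_zero_sub_max_zero_mem_Icc {x y : ℝ} (h : x ≤ y) :
    max y 0 - max x 0 ∈ Set.Icc 0 (y - x) := by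
  constructor <;> rcases le_total y 0 with hy | hy <;> rcases le_total x 0 with hx | hx <;>
    simp only [hy, hx, max_eq_left, max_eq_right] <;> linarith

/-- Explicit optimal quadratic-spline interpolant (with a flat middle piece)
in the regime `0 < c < c₀`, i.e. `2c(a+b) < a² + b²`. -/
theorem explicit_interpolant_small_c
    (a b c M τ₁ τ₂ : ℝ) (ha : 0 ≤ a) (hb : 0 ≤ b) (hc : 0 < c)
    (hreg : 2 * c * (a + b) < a ^ 2 + b ^ 2)
    (hM : M = (a ^ 2 + b ^ 2) / (2 * c))
    (hτ₁ : τ₁ = a / M) (hτ₂ : τ₂ = 1 - b / M)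
    (G : ℝ → ℝ)
    (hGdef : ∀ t, G t =
      if t ≤ τ₁ then -(M / 2) * t ^ 2 + a * t
      else if t ≤ τ₂ then a ^ 2 / (2 * M)
      else M / 2 * (t - 1) ^ 2 + b * (t - 1) + (a ^ 2 + b ^ 2) / (2 * M)) :
    G 0 = 0 ∧ G 1 = c ∧
    ∃ g : ℝ → ℝ,
      (∀ t ∈ Set.Icc (0:ℝ) 1, HasDerivWithinAt G (g t) (Set.Icc (0:ℝ) 1) t) ∧
      g 0 = a ∧ g 1 = b ∧
      (∀ t ∈ Set.Icc (0:ℝ) 1, 0 ≤ g t) ∧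
      (∀ s ∈ Set.Icc (0:ℝ) 1, ∀ t ∈ Set.Icc (0:ℝ) 1, |g s - g t| ≤ M * |s - t|) := by
  have hab : 0 < a ^ 2 + b ^ 2 := lt_of_le_of_lt (by positivity) hreg
  have hMpos : 0 < M := hM ▸ by positivity
  have hMc : (a ^ 2 + b ^ 2) / (2 * M) = c := by
    rw [hM]; field_simp
  have habM : a + b < M := by
    rw [hM, lt_div_iff₀ (by positivity)]; linarith
  have hG : G = fun t => a ^ 2 / (2 * M) - max (a - M * t) 0 ^ 2 / (2 * M)
      + max (b - M * (1 - t)) 0 ^ 2 / (2 * M) := by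
    funext t
    have h1 : t ≤ τ₁ ↔ M * t ≤ a := by rw [hτ₁, le_div_iff₀ hMpos, mul_comm]
    have h2 : t ≤ τ₂ ↔ b ≤ M * (1 - t) := by
      rw [hτ₂, le_sub_comm, div_le_iff₀ hMpos, mul_comm]
    rw [hGdef]
    simp only [h1, h2]
    split_ifs with ht ht'
    · rw [max_eq_left (by linarith), max_eq_right (by linarith)]
      field_simp
      ring
    · rw [max_eq_right (by linarith), max_eq_right (by linarith)]
      ring
    · rw [max_eq_right (by linarith), max_eq_left (by linarith)]
      field_simp
      ring
  have hMa : a ≤ M := by linarith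
  have hMb : b ≤ M := by linarith
  refine ⟨?_, ?_, fun t => max (a - M * t) 0 + max (b - M * (1 - t)) 0, ?_, ?_, ?_, ?_, ?_⟩
  · simp [hG, ha, hMb]
  · simp [hG, hb, hMa, ← hMc, add_div]
  · intro t _
    have hu : HasDerivAt (fun t : ℝ => a - M * t) (-M) t := by
      simpa using ((hasDerivAt_id t).const_mul M).const_sub a
    have hv : HasDerivAt (fun t : ℝ => b - M * (1 - t)) M t := by
      simpa using (((hasDerivAt_id t).const_sub 1).const_mul M).const_sub b
    have hu2 := (((hasDerivAt_max_zero_sq (a - M * t)).comp t hu).div_const (2 * M)).const_sub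
      (a ^ 2 / (2 * M))
    have hv2 := ((hasDerivAt_max_zero_sq (b - M * (1 - t))).comp t hv).div_const (2 * M)
    rw [hG]
    refine ((hu2.add hv2).congr_deriv ?_).hasDerivWithinAt
    field_simp
  · simp [ha, hMb]
  · simp [hb, hMa]
  · intro t _
    positivity
  · intro s _ t _
    wlog hst : s ≤ t generalizing s t
    · rw [abs_sub_comm, abs_sub_comm s t]
      exact this t ‹_› s ‹_› (le_of_not_ge hst)
    have hMst : M * s ≤ M * t := mul_le_mul_of_nonneg_left hst hMpos.le
    obtain ⟨h1, h2⟩ := max_zero_sub_max_zero_mem_Icc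
      (show a - M * t ≤ a - M * s by linarith)
    obtain ⟨h3, h4⟩ := max_zero_sub_max_zero_mem_Icc
      (show b - M * (1 - s) ≤ b - M * (1 - t) by linarith)
    rw [abs_sub_comm s t, abs_of_nonneg (sub_nonneg.2 hst), abs_le]
    constructor <;> linarith
end

section
/- Let N ≥ 1, let x₀ < x₁ < ⋯ < x_N be real numbers, E = {x₀,…,x_N}, and let f : E → ℝ satisfy f(x₀) ≤ f(x₁) ≤ ⋯ ≤ f(x_N). For 0 ≤ i ≤ N−1 set hᵢ := x_{i+1} − xᵢ and sᵢ := (f(x_{i+1}) − f(xᵢ))/hᵢ. Then, as elements of [0, ∞], the infimum of ‖F''‖_{L∞([x₀,x_N])} over all F ∈ C^{1,1}([x₀,x_N]) with F(xᵢ) = f(xᵢ) for all i and F'(x) ≥ 0 for all x ∈ [x₀,x_N] equals the infimum, over all vectors d = (d₀,…,d_N) with dᵢ ≥ 0 for all i, of max_{0 ≤ i ≤ N−1} M*(dᵢ, d_{i+1}, sᵢ)/hᵢ. -/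
open Set

/-- The optimal `C^{1,1}` curvature `M*(a,b,c) ∈ [0,∞]` for the two-point monotone
Hermite problem on `[0,1]` with data `G(0)=0, G(1)=c, G'(0)=a, G'(1)=b`. -/
noncomputable def Mstar (a b c : ℝ) : ENNReal :=
  if c = 0 then (if a + b = 0 then 0 else ⊤)
  else if 0 < a + b ∧ 2 * c * (a + b) ≤ a ^ 2 + b ^ 2 then
    ENNReal.ofReal ((a ^ 2 + b ^ 2) / (2 * c))
  else ENNReal.ofReal (|2 * c - a - b| + Real.sqrt ((2 * c - a - b) ^ 2 + (b - a) ^ 2))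

/-- The least `K`-Lipschitz nonnegative function on `[0,1]` with end values `a` and `b`. -/
noncomputable def lowerEnvelope (a b K t : ℝ) : ℝ :=
  max 0 (max (a - K * |t|) (b - K * |1 - t|))

/-- The greatest `K`-Lipschitz function on `[0,1]` with end values `a` and `b`. -/
noncomputable def upperEnvelope (a b K t : ℝ) : ℝ :=
  min (a + K * |t|) (b + K * |1 - t|)

lemma continuous_lowerEnvelope (a b K : ℝ) : Continuous (lowerEnvelope a b K) := by
  unfold lowerEnvelope; fun_prop

lemma continuous_upperEnvelope (a b K : ℝ) : Continuous (upperEnvelope a b K) := by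
  unfold upperEnvelope; fun_prop

lemma abs_mul_abs_sub_mul_abs_le {K : ℝ} (hK : 0 ≤ K) (u v : ℝ) :
    |(K * |u|) - (K * |v|)| ≤ K * |u - v| := by
  rw [← mul_sub, abs_mul, abs_of_nonneg hK]
  exact mul_le_mul_of_nonneg_left (abs_abs_sub_abs_le u v) hK

lemma abs_lowerEnvelope_sub_le {K : ℝ} (hK : 0 ≤ K) (a b s t : ℝ) :
    |lowerEnvelope a b K s - lowerEnvelope a b K t| ≤ K * |s - t| := by
  have h1 := abs_mul_abs_sub_mul_abs_le hK s t
  have h2 := abs_mul_abs_sub_mul_abs_le hK (1 - s) (1 - t)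
  rw [show 1 - s - (1 - t) = -(s - t) by ring, abs_neg] at h2
  have h0 : 0 ≤ K * |s - t| := by positivity
  unfold lowerEnvelope
  rw [abs_le] at *
  grind

lemma abs_upperEnvelope_sub_le {K : ℝ} (hK : 0 ≤ K) (a b s t : ℝ) :
    |upperEnvelope a b K s - upperEnvelope a b K t| ≤ K * |s - t| := by
  have h1 := abs_mul_abs_sub_mul_abs_le hK s t
  have h2 := abs_mul_abs_sub_mul_abs_le hK (1 - s) (1 - t)
  rw [show 1 - s - (1 - t) = -(s - t) by ring, abs_neg] at h2
  unfold upperEnvelope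
  rw [abs_le] at *
  grind

lemma integral_eq_of_eqOn_affine {φ : ℝ → ℝ} {u v α β : ℝ} (huv : u ≤ v)
    (h : ∀ t ∈ Icc u v, φ t = α + β * t) :
    ∫ t in u..v, φ t = α * (v - u) + β * ((v ^ 2 - u ^ 2) / 2) := by
  rw [intervalIntegral.integral_congr (g := fun t => α + β * t)
    (by rw [uIcc_of_le huv]; exact h)]
  rw [intervalIntegral.integral_add (by simp)
    (Continuous.intervalIntegrable (by fun_prop) _ _),
    intervalIntegral.integral_const_mul]
  simp
  ring

lemma integral_upperEnvelope {a b K : ℝ} (hK : 0 ≤ K) (hab : |b - a| ≤ K) :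
    ∫ t in (0 : ℝ)..1, upperEnvelope a b K t =
      (a + b) / 2 + K / 4 - (b - a) ^ 2 / (4 * K) := by
  have hc := continuous_upperEnvelope a b K
  rw [abs_le] at hab
  rcases hK.eq_or_lt with rfl | hK
  · rw [integral_eq_of_eqOn_affine (α := a) (β := 0) zero_le_one]
    · have : a = b := by linarith
      subst this; simp
    · intro t _
      have : a = b := by linarith
      subst this
      simp [upperEnvelope]
  set m : ℝ := (b - a + K) / (2 * K) with hm
  have hmK : 2 * (K * m) = b - a + K := by rw [hm]; field_simp
  have hm0 : 0 ≤ m := div_nonneg (by linarith) (by linarith)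
  have hm1 : m ≤ 1 := by rw [hm, div_le_one (by linarith)]; linarith
  rw [← intervalIntegral.integral_add_adjacent_intervals (b := m)
    (hc.intervalIntegrable _ _) (hc.intervalIntegrable _ _),
    integral_eq_of_eqOn_affine (α := a) (β := K) hm0,
    integral_eq_of_eqOn_affine (α := b + K) (β := -K) hm1]
  · rw [hm]; field_simp; ring
  · intro t ht
    have := mul_le_mul_of_nonneg_left ht.1 hK.le
    rw [upperEnvelope, abs_of_nonneg (hm0.trans ht.1), abs_of_nonneg (by linarith [ht.2]),
      min_eq_right (by linarith)]
    ring
  · intro t ht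
    have := mul_le_mul_of_nonneg_left ht.2 hK.le
    rw [upperEnvelope, abs_of_nonneg ht.1, abs_of_nonneg (by linarith [ht.2]),
      min_eq_left (by linarith)]

lemma integral_lowerEnvelope_of_le {a b K : ℝ} (ha : 0 ≤ a) (hK : 0 ≤ K)
    (hab : |b - a| ≤ K) (hle : K ≤ a + b) :
    ∫ t in (0 : ℝ)..1, lowerEnvelope a b K t =
      (a + b) / 2 - K / 4 + (b - a) ^ 2 / (4 * K) := by
  have hc := continuous_lowerEnvelope a b K
  rw [abs_le] at hab
  rcases hK.eq_or_lt with rfl | hK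
  · rw [integral_eq_of_eqOn_affine (α := a) (β := 0) zero_le_one]
    · have : a = b := by linarith
      subst this; simp
    · intro t _
      have : a = b := by linarith
      subst this
      simp [lowerEnvelope, ha]
  set m : ℝ := (a - b + K) / (2 * K) with hm
  have hmK : 2 * (K * m) = a - b + K := by rw [hm]; field_simp
  have hm0 : 0 ≤ m := div_nonneg (by linarith) (by linarith)
  have hm1 : m ≤ 1 := by rw [hm, div_le_one (by linarith)]; linarith
  rw [← intervalIntegral.integral_add_adjacent_intervals (b := m)
    (hc.intervalIntegrable _ _) (hc.intervalIntegrable _ _),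
    integral_eq_of_eqOn_affine (α := a) (β := -K) hm0,
    integral_eq_of_eqOn_affine (α := b - K) (β := K) hm1]
  · rw [hm]; field_simp; ring
  · intro t ht
    have := mul_le_mul_of_nonneg_left ht.1 hK.le
    rw [lowerEnvelope, abs_of_nonneg (hm0.trans ht.1), abs_of_nonneg (by linarith [ht.2]),
      max_eq_right (a := a - K * t) (by linarith), max_eq_right (by linarith)]
    ring
  · intro t ht
    have := mul_le_mul_of_nonneg_left ht.2 hK.le
    rw [lowerEnvelope, abs_of_nonneg ht.1, abs_of_nonneg (by linarith [ht.2]),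
      max_eq_left (a := a - K * t) (by linarith), max_eq_right (by linarith)]
    ring

lemma integral_lowerEnvelope_of_ge {a b K : ℝ} (ha : 0 ≤ a) (hb : 0 ≤ b) (hK : 0 < K)
    (hle : a + b ≤ K) :
    ∫ t in (0 : ℝ)..1, lowerEnvelope a b K t = (a ^ 2 + b ^ 2) / (2 * K) := by
  have hc := continuous_lowerEnvelope a b K
  set m : ℝ := a / K with hm
  set n : ℝ := 1 - b / K with hn
  have hmK : K * m = a := by rw [hm]; field_simp
  have hnK : K * n = K - b := by rw [hn]; field_simp
  have hm0 : 0 ≤ m := by positivity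
  have hmn : m ≤ n := by
    refine le_of_mul_le_mul_left ?_ hK
    linarith
  have hn1 : n ≤ 1 := by
    have : 0 ≤ b / K := by positivity
    linarith
  rw [← intervalIntegral.integral_add_adjacent_intervals (b := m)
    (hc.intervalIntegrable _ _) (hc.intervalIntegrable _ _),
    ← intervalIntegral.integral_add_adjacent_intervals (a := m) (b := n)
    (hc.intervalIntegrable _ _) (hc.intervalIntegrable _ _),
    integral_eq_of_eqOn_affine (α := a) (β := -K) hm0,
    integral_eq_of_eqOn_affine (α := 0) (β := 0) hmn,
    integral_eq_of_eqOn_affine (α := b - K) (β := K) hn1]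
  · rw [hm, hn]; field_simp; ring
  · intro t ht
    have := mul_le_mul_of_nonneg_left ht.1 hK.le
    rw [lowerEnvelope, abs_of_nonneg (by linarith [ht.1]), abs_of_nonneg (by linarith [ht.2]),
      max_eq_right (a := a - K * t) (by linarith), max_eq_right (by linarith)]
    ring
  · intro t ht
    have := mul_le_mul_of_nonneg_left ht.1 hK.le
    have := mul_le_mul_of_nonneg_left ht.2 hK.le
    rw [lowerEnvelope, abs_of_nonneg (by linarith [ht.1]), abs_of_nonneg (by linarith [ht.2]),
      max_eq_left (max_le (by linarith) (by linarith))]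
    ring
  · intro t ht
    have := mul_le_mul_of_nonneg_left ht.2 hK.le
    rw [lowerEnvelope, abs_of_nonneg ht.1, abs_of_nonneg (by linarith [ht.2]),
      max_eq_left (a := a - K * t) (by linarith), max_eq_right (by linarith)]
    ring

lemma le_integral_upperEnvelope_iff {a b c K : ℝ} (hK : 0 < K) (hab : |b - a| ≤ K) :
    c ≤ ∫ t in (0 : ℝ)..1, upperEnvelope a b K t ↔
      2 * K * (2 * c - a - b) ≤ K ^ 2 - (b - a) ^ 2 := by
  rw [integral_upperEnvelope hK.le hab, show (a + b) / 2 + K / 4 - (b - a) ^ 2 / (4 * K) =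
    (2 * K * (a + b) + K ^ 2 - (b - a) ^ 2) / (4 * K) by field_simp; ring,
    le_div_iff₀ (by positivity)]
  constructor <;> intro h <;> linarith

lemma integral_lowerEnvelope_le_iff_of_le {a b c K : ℝ} (ha : 0 ≤ a) (hK : 0 < K)
    (hab : |b - a| ≤ K) (hle : K ≤ a + b) :
    ∫ t in (0 : ℝ)..1, lowerEnvelope a b K t ≤ c ↔
      -(2 * K * (2 * c - a - b)) ≤ K ^ 2 - (b - a) ^ 2 := by
  rw [integral_lowerEnvelope_of_le ha hK.le hab hle,
    show (a + b) / 2 - K / 4 + (b - a) ^ 2 / (4 * K) =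
    (2 * K * (a + b) - K ^ 2 + (b - a) ^ 2) / (4 * K) by field_simp; ring,
    div_le_iff₀ (by positivity)]
  constructor <;> intro h <;> linarith

lemma integral_lowerEnvelope_le_iff_of_ge {a b c K : ℝ} (ha : 0 ≤ a) (hb : 0 ≤ b) (hK : 0 < K)
    (hle : a + b ≤ K) :
    ∫ t in (0 : ℝ)..1, lowerEnvelope a b K t ≤ c ↔ a ^ 2 + b ^ 2 ≤ 2 * c * K := by
  rw [integral_lowerEnvelope_of_ge ha hb hK hle, div_le_iff₀ (by positivity)]
  constructor <;> intro h <;> linarith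

lemma Mstar_le_ofReal_iff {a b c K : ℝ} (ha : 0 ≤ a) (hb : 0 ≤ b) (hc : 0 ≤ c) (hK : 0 ≤ K) :
    Mstar a b c ≤ ENNReal.ofReal K ↔ |b - a| ≤ K ∧
      ∫ t in (0 : ℝ)..1, lowerEnvelope a b K t ≤ c ∧
      c ≤ ∫ t in (0 : ℝ)..1, upperEnvelope a b K t := by
  have hD : ∀ {L : ℝ}, 0 ≤ L → (|b - a| ≤ L ↔ (b - a) ^ 2 ≤ L ^ 2) := fun hL => by
    rw [← sq_abs (b - a), pow_le_pow_iff_left₀ (abs_nonneg _) hL two_ne_zero]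
  rcases hK.eq_or_lt with rfl | hK
  · have hU : |b - a| ≤ 0 ∧ ∫ t in (0 : ℝ)..1, lowerEnvelope a b 0 t ≤ c ∧
        c ≤ ∫ t in (0 : ℝ)..1, upperEnvelope a b 0 t ↔ a = b ∧ a = c := by
      refine ⟨fun ⟨h, h1, h2⟩ => ?_, ?_⟩
      · rw [integral_upperEnvelope le_rfl h] at h2
        rw [integral_lowerEnvelope_of_le ha le_rfl h (by linarith)] at h1
        have : b - a = 0 := abs_nonpos_iff.mp h
        simp at h1 h2
        constructor <;> linarith
      · rintro ⟨rfl, rfl⟩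
        rw [integral_upperEnvelope le_rfl (by simp),
          integral_lowerEnvelope_of_le ha le_rfl (by simp) (by linarith)]
        simp
    rw [hU, ENNReal.ofReal_zero, nonpos_iff_eq_zero, Mstar]
    split_ifs with h1 h2 h3
    · simp only [true_iff]
      constructor <;> linarith
    · simp only [ENNReal.top_ne_zero, false_iff]
      rintro ⟨rfl, rfl⟩
      exact h2 (by linarith)
    · obtain ⟨h3, h4⟩ := h3
      rw [ENNReal.ofReal_eq_zero]
      have hc' : 0 < c := lt_of_le_of_ne hc (Ne.symm h1)
      constructor
      · intro h
        have : 0 < (a ^ 2 + b ^ 2) / (2 * c) :=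
          div_pos (lt_of_lt_of_le (by positivity) h4) (by positivity)
        linarith
      · rintro ⟨rfl, rfl⟩
        nlinarith
    · rw [ENNReal.ofReal_eq_zero]
      constructor
      · intro h
        have h5 := abs_nonneg (2 * c - a - b)
        have h6 := Real.sqrt_nonneg ((2 * c - a - b) ^ 2 + (b - a) ^ 2)
        have h7 : |2 * c - a - b| = 0 := by linarith
        rw [abs_eq_zero] at h7
        have h8 : Real.sqrt ((2 * c - a - b) ^ 2 + (b - a) ^ 2) = 0 := by linarith
        rw [Real.sqrt_eq_zero (by positivity), h7] at h8
        have : b - a = 0 := by simpa using h8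
        constructor <;> linarith
      · rintro ⟨rfl, rfl⟩
        rw [show 2 * a - a - a = 0 by ring]
        simp
  have hS : |b - a| ≤ a + b := abs_le.mpr ⟨by linarith, by linarith⟩
  rw [Mstar]
  split_ifs with h1 h2 h3
  · have ha' : a = 0 := by linarith
    have hb' : b = 0 := by linarith
    subst h1 ha' hb'
    simp only [zero_le, true_iff]
    have h : |(0 : ℝ) - 0| ≤ K := by simpa using hK.le
    refine ⟨h, ?_, ?_⟩
    · rw [integral_lowerEnvelope_le_iff_of_ge le_rfl le_rfl hK (by linarith)]
      simp
    · rw [le_integral_upperEnvelope_iff hK h]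
      nlinarith
  · subst h1
    have hpos : 0 < a + b := lt_of_le_of_ne (by linarith) (Ne.symm h2)
    simp only [top_le_iff, ENNReal.ofReal_ne_top, false_iff]
    rintro ⟨h, h4, -⟩
    rcases le_total K (a + b) with hle | hle
    · rw [integral_lowerEnvelope_le_iff_of_le ha hK h hle] at h4
      nlinarith [mul_pos hK hpos, mul_nonneg hK.le (sub_nonneg.2 hle), sq_nonneg (b - a)]
    · rw [integral_lowerEnvelope_le_iff_of_ge ha hb hK hle] at h4
      nlinarith [sq_nonneg (b - a), mul_pos hpos hpos]
  · obtain ⟨hpos, h4⟩ := h3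
    have hc' : 0 < c := lt_of_le_of_ne hc (Ne.symm h1)
    rw [ENNReal.ofReal_le_ofReal_iff hK.le, div_le_iff₀ (by positivity)]
    constructor
    · intro h
      have hle : a + b ≤ K := le_of_mul_le_mul_left (h4.trans (h.trans_eq (mul_comm _ _)))
        (by positivity : 0 < 2 * c)
      have habK := hS.trans hle
      have hD' := (hD hK.le).1 habK
      refine ⟨habK, ?_, ?_⟩
      · rw [integral_lowerEnvelope_le_iff_of_ge ha hb hK hle]
        linarith
      · rw [le_integral_upperEnvelope_iff hK habK]
        have h5 : 2 * c ≤ a + b := by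
          refine le_of_mul_le_mul_right ?_ hpos
          nlinarith [mul_nonneg ha hb]
        nlinarith [mul_nonneg hK.le (sub_nonneg.2 h5)]
    · rintro ⟨h, h5, -⟩
      rcases lt_or_ge K (a + b) with hle | hle
      · rw [integral_lowerEnvelope_le_iff_of_le ha hK h hle.le] at h5
        exfalso
        have h6 := mul_le_mul_of_nonneg_right h5 hpos.le
        have h7 := mul_le_mul_of_nonneg_right h4 hK.le
        have h8 : 0 < K * (a + b) * (a + b - K) :=
          mul_pos (mul_pos hK hpos) (sub_pos.2 hle)
        have h9 : 0 ≤ (b - a) ^ 2 * (a + b - K) := mul_nonneg (sq_nonneg _) (sub_pos.2 hle).le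
        nlinarith
      · rw [integral_lowerEnvelope_le_iff_of_ge ha hb hK hle] at h5
        linarith
  · have h4 : a ^ 2 + b ^ 2 ≤ 2 * c * (a + b) := by
      by_contra! h
      refine h3 ⟨?_, h.le⟩
      by_contra! h0
      have ha' : a = 0 := by linarith
      have hb' : b = 0 := by linarith
      subst ha' hb'
      simp at h
    have hM : |2 * c - a - b| + √((2 * c - a - b) ^ 2 + (b - a) ^ 2) ≤ K ↔
        2 * K * |2 * c - a - b| ≤ K ^ 2 - (b - a) ^ 2 := by
      rw [← sq_abs (2 * c - a - b)]
      set e := |2 * c - a - b|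
      have he : 0 ≤ e := abs_nonneg _
      rw [← le_sub_iff_add_le']
      constructor
      · intro h
        have h0 : 0 ≤ K - e := (Real.sqrt_nonneg _).trans h
        rw [Real.sqrt_le_left h0] at h
        nlinarith
      · intro h
        have h0 : e ≤ K := by
          refine le_of_mul_le_mul_left ?_ hK
          nlinarith [sq_nonneg (b - a), mul_nonneg hK.le he]
        rw [Real.sqrt_le_left (by linarith)]
        nlinarith
    have habs : 2 * K * |2 * c - a - b| ≤ K ^ 2 - (b - a) ^ 2 ↔
        2 * K * (2 * c - a - b) ≤ K ^ 2 - (b - a) ^ 2 ∧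
        -(2 * K * (2 * c - a - b)) ≤ K ^ 2 - (b - a) ^ 2 := by
      rw [← abs_of_pos (by positivity : 0 < 2 * K), ← abs_mul, abs_le', abs_of_pos (by positivity)]
    rw [ENNReal.ofReal_le_ofReal_iff hK.le, hM, habs]
    constructor
    · rintro ⟨h5, h6⟩
      have h : |b - a| ≤ K := (hD hK.le).2 (by linarith)
      refine ⟨h, ?_, (le_integral_upperEnvelope_iff hK h).2 h5⟩
      rcases le_total K (a + b) with hle | hle
      · exact (integral_lowerEnvelope_le_iff_of_le ha hK h hle).2 h6
      · rw [integral_lowerEnvelope_le_iff_of_ge ha hb hK hle]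
        exact h4.trans (mul_le_mul_of_nonneg_left hle (by linarith))
    · rintro ⟨h, h5, h6⟩
      rw [le_integral_upperEnvelope_iff hK h] at h6
      refine ⟨h6, ?_⟩
      rcases le_total K (a + b) with hle | hle
      · exact (integral_lowerEnvelope_le_iff_of_le ha hK h hle).1 h5
      · rw [integral_lowerEnvelope_le_iff_of_ge ha hb hK hle] at h5
        nlinarith [sq_nonneg (K - a - b)]

lemma lowerEnvelope_le_of_lipschitz {g : ℝ → ℝ} {K t : ℝ}
    (hg : ∀ s ∈ Icc (0 : ℝ) 1, ∀ t ∈ Icc (0 : ℝ) 1, |g s - g t| ≤ K * |s - t|)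
    (hg0 : ∀ t ∈ Icc (0 : ℝ) 1, 0 ≤ g t) (ht : t ∈ Icc (0 : ℝ) 1) :
    lowerEnvelope (g 0) (g 1) K t ≤ g t := by
  have h0 := (abs_le.1 (hg t ht 0 (by simp))).1
  have h1 := (abs_le.1 (hg 1 (by simp) t ht)).2
  rw [sub_zero] at h0
  exact max_le (hg0 t ht) (max_le (by linarith) (by linarith))

lemma le_upperEnvelope_of_lipschitz {g : ℝ → ℝ} {K t : ℝ}
    (hg : ∀ s ∈ Icc (0 : ℝ) 1, ∀ t ∈ Icc (0 : ℝ) 1, |g s - g t| ≤ K * |s - t|)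
    (ht : t ∈ Icc (0 : ℝ) 1) :
    g t ≤ upperEnvelope (g 0) (g 1) K t := by
  have h0 := (abs_le.1 (hg t ht 0 (by simp))).2
  have h1 := (abs_le.1 (hg 1 (by simp) t ht)).1
  rw [sub_zero] at h0
  exact le_min (by linarith) (by linarith)

lemma continuousOn_of_abs_sub_le {g : ℝ → ℝ} {K : ℝ} {S : Set ℝ} (hK : 0 ≤ K)
    (hg : ∀ s ∈ S, ∀ t ∈ S, |g s - g t| ≤ K * |s - t|) : ContinuousOn g S :=
  (LipschitzOnWith.of_dist_le_mul (K := ⟨K, hK⟩) hg).continuousOn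

lemma Mstar_le_of_lipschitz_unit {g : ℝ → ℝ} {K : ℝ} (hK : 0 ≤ K)
    (hg : ∀ s ∈ Icc (0 : ℝ) 1, ∀ t ∈ Icc (0 : ℝ) 1, |g s - g t| ≤ K * |s - t|)
    (hg0 : ∀ t ∈ Icc (0 : ℝ) 1, 0 ≤ g t) :
    Mstar (g 0) (g 1) (∫ t in (0 : ℝ)..1, g t) ≤ ENNReal.ofReal K := by
  have hint : IntervalIntegrable g MeasureTheory.volume 0 1 := by
    refine ContinuousOn.intervalIntegrable ?_
    rw [uIcc_of_le zero_le_one]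
    exact continuousOn_of_abs_sub_le hK hg
  rw [Mstar_le_ofReal_iff (hg0 0 (by simp)) (hg0 1 (by simp))
    (intervalIntegral.integral_nonneg zero_le_one hg0) hK]
  refine ⟨by simpa using hg 1 (by simp) 0 (by simp), ?_, ?_⟩
  · exact intervalIntegral.integral_mono_on zero_le_one
      ((continuous_lowerEnvelope _ _ _).intervalIntegrable _ _) hint
      fun t ht => lowerEnvelope_le_of_lipschitz hg hg0 ht
  · exact intervalIntegral.integral_mono_on zero_le_one hint
      ((continuous_upperEnvelope _ _ _).intervalIntegrable _ _)
      fun t ht => le_upperEnvelope_of_lipschitz hg ht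

lemma Mstar_le_of_lipschitz {g : ℝ → ℝ} {K p q : ℝ} (hK : 0 ≤ K) (hpq : p < q)
    (hg : ∀ s ∈ Icc p q, ∀ t ∈ Icc p q, |g s - g t| ≤ K * |s - t|)
    (hg0 : ∀ t ∈ Icc p q, 0 ≤ g t) :
    Mstar (g p) (g q) ((∫ t in p..q, g t) / (q - p)) ≤ ENNReal.ofReal (K * (q - p)) := by
  have h : 0 < q - p := sub_pos.2 hpq
  have hmem : ∀ u ∈ Icc (0 : ℝ) 1, (q - p) * u + p ∈ Icc p q := fun u hu =>
    ⟨by nlinarith [mul_nonneg h.le hu.1], by nlinarith [mul_le_mul_of_nonneg_left hu.2 h.le]⟩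
  have key := Mstar_le_of_lipschitz_unit (g := fun u => g ((q - p) * u + p))
    (K := K * (q - p)) (by positivity) (fun s hs t ht => by
      refine (hg _ (hmem s hs) _ (hmem t ht)).trans_eq ?_
      rw [show (q - p) * s + p - ((q - p) * t + p) = (q - p) * (s - t) by ring, abs_mul,
        abs_of_pos h, mul_assoc]) (fun t ht => hg0 _ (hmem t ht))
  rw [intervalIntegral.integral_comp_mul_add _ h.ne'] at key
  simpa [div_eq_inv_mul] using key

lemma exists_lipschitz_interpolant_unit {a b c K : ℝ} (ha : 0 ≤ a) (hb : 0 ≤ b) (hc : 0 ≤ c)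
    (hK : 0 ≤ K) (h : Mstar a b c ≤ ENNReal.ofReal K) :
    ∃ g : ℝ → ℝ, (∀ s t, |g s - g t| ≤ K * |s - t|) ∧ (∀ t, 0 ≤ g t) ∧ g 0 = a ∧ g 1 = b ∧
      ∫ t in (0 : ℝ)..1, g t = c := by
  obtain ⟨hab, hL, hU⟩ := (Mstar_le_ofReal_iff ha hb hc hK).1 h
  rw [abs_le] at hab
  have hmem : c ∈ segment ℝ (∫ t in (0 : ℝ)..1, lowerEnvelope a b K t)
      (∫ t in (0 : ℝ)..1, upperEnvelope a b K t) := by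
    rw [segment_eq_Icc (hL.trans hU)]
    exact ⟨hL, hU⟩
  obtain ⟨l, m, hl, hm, hlm, hc'⟩ := hmem
  refine ⟨fun t => l * lowerEnvelope a b K t + m * upperEnvelope a b K t, fun s t => ?_,
    fun t => ?_, ?_, ?_, ?_⟩
  · have h1 := abs_le.1 (abs_lowerEnvelope_sub_le hK a b s t)
    have h2 := abs_le.1 (abs_upperEnvelope_sub_le hK a b s t)
    have h3 : l * (K * |s - t|) + m * (K * |s - t|) = K * |s - t| := by
      rw [← add_mul, hlm, one_mul]
    have := mul_le_mul_of_nonneg_left h1.1 hl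
    have := mul_le_mul_of_nonneg_left h1.2 hl
    have := mul_le_mul_of_nonneg_left h2.1 hm
    have := mul_le_mul_of_nonneg_left h2.2 hm
    exact abs_le.2 ⟨by linarith, by linarith⟩
  · have h1 : 0 ≤ lowerEnvelope a b K t := le_max_left _ _
    have h2 : 0 ≤ upperEnvelope a b K t := le_min (by positivity) (by positivity)
    positivity
  · have h1 : lowerEnvelope a b K 0 = a := by
      simp [lowerEnvelope, max_eq_left (show b - K ≤ a by linarith), ha]
    have h2 : upperEnvelope a b K 0 = a := by
      simp [upperEnvelope]; linarith
    simp only [h1, h2, ← add_mul, hlm, one_mul]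
  · have h1 : lowerEnvelope a b K 1 = b := by
      simp [lowerEnvelope, max_eq_right (show a - K ≤ b by linarith), hb]
    have h2 : upperEnvelope a b K 1 = b := by
      simp [upperEnvelope]; linarith
    simp only [h1, h2, ← add_mul, hlm, one_mul]
  · rw [intervalIntegral.integral_add
      (((continuous_lowerEnvelope _ _ _).const_mul _).intervalIntegrable _ _)
      (((continuous_upperEnvelope _ _ _).const_mul _).intervalIntegrable _ _),
      intervalIntegral.integral_const_mul, intervalIntegral.integral_const_mul]
    exact hc'

lemma exists_lipschitz_interpolant {a b c K p q : ℝ} (ha : 0 ≤ a) (hb : 0 ≤ b) (hc : 0 ≤ c)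
    (hK : 0 ≤ K) (hpq : p < q)
    (h : Mstar a b (c / (q - p)) ≤ ENNReal.ofReal (K * (q - p))) :
    ∃ g : ℝ → ℝ, (∀ s t, |g s - g t| ≤ K * |s - t|) ∧ (∀ t, 0 ≤ g t) ∧ g p = a ∧ g q = b ∧
      ∫ t in p..q, g t = c := by
  have hpos : 0 < q - p := sub_pos.2 hpq
  obtain ⟨g, hg, hg0, hga, hgb, hgc⟩ :=
    exists_lipschitz_interpolant_unit ha hb (by positivity) (by positivity) h
  refine ⟨fun t => g ((t - p) / (q - p)), fun s t => ?_, fun t => hg0 _, by simpa using hga,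
    by simpa [div_self hpos.ne'] using hgb, ?_⟩
  · refine (hg _ _).trans_eq ?_
    rw [← sub_div, sub_sub_sub_cancel_right, abs_div, abs_of_pos hpos]
    field_simp
  · rw [intervalIntegral.integral_comp_sub_right (fun t => g (t / (q - p))),
      intervalIntegral.integral_comp_div _ hpos.ne', sub_self, zero_div, div_self hpos.ne', hgc,
      smul_eq_mul]
    field_simp

lemma abs_ite_sub_ite_le {g₁ g₂ : ℝ → ℝ} {K x : ℝ} (h₁ : ∀ s t, |g₁ s - g₁ t| ≤ K * |s - t|)
    (h₂ : ∀ s t, |g₂ s - g₂ t| ≤ K * |s - t|) (hx : g₁ x = g₂ x) (s t : ℝ) :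
    |(if s ≤ x then g₁ s else g₂ s) - (if t ≤ x then g₁ t else g₂ t)| ≤ K * |s - t| := by
  wlog hst : s ≤ t generalizing s t
  · rw [abs_sub_comm, abs_sub_comm s]
    exact this t s (le_of_not_ge hst)
  split_ifs with hs ht ht
  · exact h₁ s t
  · have ht' := (not_le.1 ht).le
    calc |g₁ s - g₂ t| = |(g₁ s - g₁ x) + (g₂ x - g₂ t)| := by rw [hx]; congr 1; ring
      _ ≤ K * |s - x| + K * |x - t| := (abs_add_le _ _).trans (add_le_add (h₁ _ _) (h₂ _ _))
      _ = K * |s - t| := by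
        rw [abs_of_nonpos (sub_nonpos.2 hs), abs_of_nonpos (sub_nonpos.2 ht'),
          abs_of_nonpos (sub_nonpos.2 hst)]
        ring
  · exact absurd (hst.trans ht) hs
  · exact h₂ s t

lemma exists_lipschitz_spline {N : ℕ} {x d : Fin (N + 1) → ℝ} {c : Fin N → ℝ} {K : ℝ}
    (hx : StrictMono x) (hd : ∀ i, 0 ≤ d i) (hc : ∀ i, 0 ≤ c i) (hK : 0 ≤ K)
    (h : ∀ i : Fin N, Mstar (d i.castSucc) (d i.succ) (c i / (x i.succ - x i.castSucc)) ≤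
      ENNReal.ofReal (K * (x i.succ - x i.castSucc))) :
    ∃ g : ℝ → ℝ, (∀ s t, |g s - g t| ≤ K * |s - t|) ∧ (∀ t, 0 ≤ g t) ∧
      ∀ i : Fin N, ∫ t in x i.castSucc..x i.succ, g t = c i := by
  suffices H : ∀ m : Fin (N + 1), ∃ g : ℝ → ℝ, (∀ s t, |g s - g t| ≤ K * |s - t|) ∧
      (∀ t, 0 ≤ g t) ∧ g (x m) = d m ∧
      ∀ i : Fin N, i.succ ≤ m → ∫ t in x i.castSucc..x i.succ, g t = c i by
    obtain ⟨g, h1, h2, -, h3⟩ := H (Fin.last N)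
    exact ⟨g, h1, h2, fun i => h3 i (Fin.le_last _)⟩
  intro m
  induction m using Fin.induction with
  | zero =>
    refine ⟨fun _ => d 0, fun s t => ?_, fun _ => hd 0, rfl, fun i hi => ?_⟩
    · simpa using mul_nonneg hK (abs_nonneg (s - t))
    · exact absurd hi (not_le.2 (Fin.succ_pos i))
  | succ m ih =>
    obtain ⟨g₁, h1, h2, h3, h4⟩ := ih
    have hlt : x m.castSucc < x m.succ := hx m.castSucc_lt_succ
    obtain ⟨g₂, k1, k2, k3, k4, k5⟩ :=
      exists_lipschitz_interpolant (hd _) (hd _) (hc m) hK hlt (h m)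
    refine ⟨fun t => if t ≤ x m.castSucc then g₁ t else g₂ t,
      abs_ite_sub_ite_le h1 k1 (h3.trans k3.symm), fun t => ?_, ?_, fun i hi => ?_⟩
    · dsimp only
      split_ifs
      exacts [h2 t, k2 t]
    · simp only [not_le.2 hlt, if_false, k4]
    · have hix : x i.castSucc ≤ x i.succ := (hx i.castSucc_lt_succ).le
      rcases (Fin.succ_le_succ_iff.1 hi).lt_or_eq with hlt' | rfl
      · have hle : i.succ ≤ m.castSucc := Fin.succ_le_castSucc_iff.2 hlt'
        rw [← h4 i hle]
        refine intervalIntegral.integral_congr fun t ht => ?_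
        rw [uIcc_of_le hix] at ht
        simp only [ht.2.trans (hx.monotone hle), if_true]
      · rw [← k5]
        refine intervalIntegral.integral_congr fun t ht => ?_
        rw [uIcc_of_le hix] at ht
        split_ifs with hle
        · rw [le_antisymm hle ht.1, h3, k3]
        · rfl

lemma edist_le_ofReal_mul_edist_iff {K a b s t : ℝ} (hK : 0 ≤ K) :
    edist a b ≤ ENNReal.ofReal K * edist s t ↔ |a - b| ≤ K * |s - t| := by
  rw [edist_dist, edist_dist, Real.dist_eq, Real.dist_eq, ← ENNReal.ofReal_mul hK,
    ENNReal.ofReal_le_ofReal_iff (by positivity)]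

/-- The monotone `C^{1,1}` trace seminorm of monotone data `f` on nodes
`x₀ < x₁ < ⋯ < x_N` equals `inf_d max_i M*(dᵢ, d_{i+1}, sᵢ)/hᵢ` over nonnegative
slope vectors `d`. -/
theorem monotone_trace_seminorm_formula
    (N : ℕ) (hN : 1 ≤ N) (x : Fin (N + 1) → ℝ) (hx : StrictMono x)
    (f : Fin (N + 1) → ℝ) (hf : Monotone f) :
    sInf { M : ENNReal | ∃ F g : ℝ → ℝ,
        (∀ t ∈ Icc (x 0) (x (Fin.last N)),
          HasDerivWithinAt F (g t) (Icc (x 0) (x (Fin.last N))) t) ∧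
        (∀ i, F (x i) = f i) ∧
        (∀ t ∈ Icc (x 0) (x (Fin.last N)), 0 ≤ g t) ∧
        (∀ s ∈ Icc (x 0) (x (Fin.last N)), ∀ t ∈ Icc (x 0) (x (Fin.last N)),
          edist (g s) (g t) ≤ M * edist s t) } =
    ⨅ d ∈ { d : Fin (N + 1) → ℝ | ∀ i, 0 ≤ d i },
      ⨆ i : Fin N,
        Mstar (d i.castSucc) (d i.succ)
            ((f i.succ - f i.castSucc) / (x i.succ - x i.castSucc)) /
          ENNReal.ofReal (x i.succ - x i.castSucc) := by
  apply le_antisymm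
  · refine le_iInf₂ fun d hd => ?_
    set S := ⨆ i : Fin N, Mstar (d i.castSucc) (d i.succ)
      ((f i.succ - f i.castSucc) / (x i.succ - x i.castSucc)) /
        ENNReal.ofReal (x i.succ - x i.castSucc) with hS
    rcases eq_or_ne S ⊤ with hT | hT
    · rw [hT]; exact le_top
    obtain ⟨K, hK, hKS⟩ : ∃ K : ℝ, 0 ≤ K ∧ S = ENNReal.ofReal K :=
      ⟨S.toReal, ENNReal.toReal_nonneg, (ENNReal.ofReal_toReal hT).symm⟩
    obtain ⟨g, h1, h2, h3⟩ := exists_lipschitz_spline (c := fun i => f i.succ - f i.castSucc)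
      hx hd (fun i => sub_nonneg.2 (hf i.castSucc_lt_succ.le)) hK (fun i => by
        have hpos : 0 < x i.succ - x i.castSucc := sub_pos.2 (hx i.castSucc_lt_succ)
        rw [ENNReal.ofReal_mul hK, ← hKS, ← ENNReal.div_le_iff
          (ENNReal.ofReal_pos.2 hpos).ne' ENNReal.ofReal_ne_top, hS]
        exact le_iSup (fun i : Fin N => Mstar (d i.castSucc) (d i.succ)
          ((f i.succ - f i.castSucc) / (x i.succ - x i.castSucc)) /
            ENNReal.ofReal (x i.succ - x i.castSucc)) i)
    have hcont : Continuous g := continuousOn_univ.1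
      (continuousOn_of_abs_sub_le hK fun s _ t _ => h1 s t)
    refine sInf_le ⟨fun t => f 0 + ∫ u in x 0..t, g u, g, fun t _ => ?_, fun i => ?_,
      fun t _ => h2 t, fun s _ t _ => ?_⟩
    · exact ((intervalIntegral.integral_hasDerivAt_right (hcont.intervalIntegrable _ _)
        (hcont.stronglyMeasurableAtFilter _ _) hcont.continuousAt).const_add _).hasDerivWithinAt
    · induction i using Fin.induction with
      | zero => simp
      | succ i ih =>
        dsimp only at ih ⊢
        rw [← intervalIntegral.integral_add_adjacent_intervals (b := x i.castSucc)
          (hcont.intervalIntegrable _ _) (hcont.intervalIntegrable _ _), ← add_assoc, ih, h3]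
        ring
    · rw [hKS, edist_le_ofReal_mul_edist_iff hK]
      exact h1 s t
  · refine le_sInf ?_
    rintro M ⟨F, g, hF, hFf, hg0, hg⟩
    have hmem : ∀ i, x i ∈ Icc (x 0) (x (Fin.last N)) := fun i =>
      ⟨hx.monotone (Fin.zero_le i), hx.monotone (Fin.le_last i)⟩
    refine iInf₂_le_of_le (fun i => g (x i)) (fun i => hg0 _ (hmem i)) (iSup_le fun i => ?_)
    have hlt : x i.castSucc < x i.succ := hx i.castSucc_lt_succ
    have hpos : 0 < ENNReal.ofReal (x i.succ - x i.castSucc) :=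
      ENNReal.ofReal_pos.2 (sub_pos.2 hlt)
    rw [ENNReal.div_le_iff hpos.ne' ENNReal.ofReal_ne_top]
    rcases eq_or_ne M ⊤ with rfl | hT
    · rw [ENNReal.top_mul hpos.ne']; exact le_top
    obtain ⟨K, hK, rfl⟩ : ∃ K : ℝ, 0 ≤ K ∧ M = ENNReal.ofReal K :=
      ⟨M.toReal, ENNReal.toReal_nonneg, (ENNReal.ofReal_toReal hT).symm⟩
    have hsub : Icc (x i.castSucc) (x i.succ) ⊆ Icc (x 0) (x (Fin.last N)) :=
      Icc_subset_Icc (hmem _).1 (hmem _).2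
    have hg' : ∀ s ∈ Icc (x i.castSucc) (x i.succ), ∀ t ∈ Icc (x i.castSucc) (x i.succ),
        |g s - g t| ≤ K * |s - t| := fun s hs t ht =>
      (edist_le_ofReal_mul_edist_iff hK).1 (hg s (hsub hs) t (hsub ht))
    have hint : ∫ t in x i.castSucc..x i.succ, g t = f i.succ - f i.castSucc := by
      rw [← hFf, ← hFf]
      refine intervalIntegral.integral_eq_sub_of_hasDerivAt_of_le hlt.le
        (fun t ht => ((hF t (hsub ht)).mono hsub).continuousWithinAt)
        (fun t ht => ((hF t (hsub (Ioo_subset_Icc_self ht))).mono hsub).hasDerivAt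
          (Icc_mem_nhds ht.1 ht.2)) ?_
      refine ContinuousOn.intervalIntegrable ?_
      rw [uIcc_of_le hlt.le]
      exact continuousOn_of_abs_sub_le hK hg'
    rw [← ENNReal.ofReal_mul hK, ← hint]
    exact Mstar_le_of_lipschitz hK hlt hg' fun t ht => hg0 t (hsub ht)
end

section
/- There exist universal constants c₀ > 0 and C₀ > 0 with the following property. Let x₁ < x₂ < x₃ be real numbers, let M > 0, d > 0, f₂ ∈ ℝ, and let F₋ : ℝ → ℝ be twice continuously differentiable on [x₁,x₂] and F₊ : ℝ → ℝ be twice continuously differentiable on [x₂,x₃], with F₋(x₂) = F₊(x₂) = f₂, F₋'(x₂) = F₊'(x₂) = d, F₋'(x) ≥ 0 on [x₁,x₂], F₊'(x) ≥ 0 on [x₂,x₃], |F₋''| ≤ M on [x₁,x₂], and |F₊''| ≤ M on [x₂,x₃]. Then for every δ with 0 < δ ≤ min{(x₂−x₁)/2, (x₃−x₂)/2, c₀·d/M}, there exists a function F̃ twice continuously differentiable on [x₁,x₃] such that: (A) F̃ = F₋ on [x₁, x₂−δ] and F̃ = F₊ on [x₂+δ, x₃]; (B) F̃(x₂) = f₂;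 (C) F̃'(x) ≥ 0 for all x ∈ [x₁,x₃]; (D) |F̃''(x)| ≤ C₀·M for all x ∈ [x₁,x₃]. -/
open Set

/-- Powers of the positive part are differentiable from the second one on. -/
theorem hasDerivAt_max_zero_pow (n : ℕ) (t : ℝ) :
    HasDerivAt (fun x : ℝ => max x 0 ^ (n + 2)) ((n + 2 : ℝ) * max t 0 ^ (n + 1)) t := by
  rcases lt_trichotomy t 0 with ht | rfl | ht
  · rw [max_eq_right ht.le, zero_pow (by omega), mul_zero]
    refine (hasDerivAt_const t (0 : ℝ)).congr_of_eventuallyEq ?_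
    filter_upwards [Iio_mem_nhds ht] with x hx
    rw [max_eq_right (le_of_lt hx), zero_pow (by omega)]
  · rw [max_self, zero_pow (by omega), mul_zero, hasDerivAt_iff_isLittleO_nhds_zero]
    have h₁ : (fun h : ℝ => h ^ (n + 2)) =o[nhds 0] fun h : ℝ => h := by
      simpa using Asymptotics.isLittleO_pow_pow (𝕜 := ℝ) (show 1 < n + 2 by omega)
    refine (Asymptotics.isBigO_of_le _ fun h => ?_).trans_isLittleO h₁
    simp only [zero_add, max_self, smul_zero, sub_zero, zero_pow (show n + 2 ≠ 0 by omega),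
      norm_pow, Real.norm_eq_abs]
    refine pow_le_pow_left₀ (abs_nonneg _) ?_ _
    rw [abs_of_nonneg (le_max_right h 0)]
    exact max_le (le_abs_self h) (abs_nonneg h)
  · rw [max_eq_left ht.le]
    have h := hasDerivAt_pow (n + 2) t
    push_cast at h
    refine h.congr_of_eventuallyEq ?_
    filter_upwards [Ioi_mem_nhds ht] with x hx
    rw [max_eq_left (le_of_lt hx)]

/-- A `C²` profile on `[0, ∞)` vanishing on `[1, ∞)`, with vanishing value and derivative
and second derivative `2` at the origin. -/
noncomputable def cutoff (t : ℝ) : ℝ := t ^ 2 * max (1 - t) 0 ^ 3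

/-- The first derivative of `cutoff`. -/
noncomputable def cutoffDeriv (t : ℝ) : ℝ :=
  2 * t * max (1 - t) 0 ^ 3 - 3 * t ^ 2 * max (1 - t) 0 ^ 2

/-- The second derivative of `cutoff`. -/
noncomputable def cutoffDeriv₂ (t : ℝ) : ℝ :=
  2 * max (1 - t) 0 ^ 3 - 12 * t * max (1 - t) 0 ^ 2 + 6 * t ^ 2 * max (1 - t) 0

theorem hasDerivAt_max_one_sub_pow (n : ℕ) (t : ℝ) :
    HasDerivAt (fun x : ℝ => max (1 - x) 0 ^ (n + 2))
      (-((n + 2 : ℝ) * max (1 - t) 0 ^ (n + 1))) t := by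
  have h := (hasDerivAt_max_zero_pow n (1 - t)).comp t ((hasDerivAt_id t).const_sub 1)
  simpa [Function.comp_def] using h

theorem hasDerivAt_cutoff (t : ℝ) : HasDerivAt cutoff (cutoffDeriv t) t := by
  have h := (hasDerivAt_pow 2 t).mul (hasDerivAt_max_one_sub_pow 1 t)
  refine h.congr_deriv ?_
  simp only [cutoffDeriv]
  push_cast
  ring

theorem hasDerivAt_cutoffDeriv (t : ℝ) : HasDerivAt cutoffDeriv (cutoffDeriv₂ t) t := by
  have h := (((hasDerivAt_id t).const_mul 2).mul (hasDerivAt_max_one_sub_pow 1 t)).sub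
    (((hasDerivAt_pow 2 t).const_mul 3).mul (hasDerivAt_max_one_sub_pow 0 t))
  refine h.congr_deriv ?_
  simp only [cutoffDeriv₂, id]
  push_cast
  ring

theorem continuous_cutoffDeriv₂ : Continuous cutoffDeriv₂ := by
  unfold cutoffDeriv₂
  fun_prop

theorem cutoff_of_one_le {t : ℝ} (ht : 1 ≤ t) : cutoff t = 0 := by
  simp [cutoff, max_eq_right (sub_nonpos.2 ht)]

theorem cutoffDeriv_of_one_le {t : ℝ} (ht : 1 ≤ t) : cutoffDeriv t = 0 := by
  simp [cutoffDeriv, max_eq_right (sub_nonpos.2 ht)]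

theorem cutoffDeriv₂_of_one_le {t : ℝ} (ht : 1 ≤ t) : cutoffDeriv₂ t = 0 := by
  simp [cutoffDeriv₂, max_eq_right (sub_nonpos.2 ht)]

theorem abs_cutoffDeriv_le {t : ℝ} (h₀ : 0 ≤ t) (h₁ : t ≤ 1) : |cutoffDeriv t| ≤ 5 := by
  have hm : 0 ≤ 1 - t := sub_nonneg.2 h₁
  have h₂ : t * (1 - t) ^ 3 ≤ 1 := mul_le_one₀ h₁ (by positivity) (pow_le_one₀ hm (by linarith))
  have h₃ : t ^ 2 * (1 - t) ^ 2 ≤ 1 :=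
    mul_le_one₀ (pow_le_one₀ h₀ h₁) (by positivity) (pow_le_one₀ hm (by linarith))
  have h₄ : 0 ≤ t * (1 - t) ^ 3 := by positivity
  have h₅ : 0 ≤ t ^ 2 * (1 - t) ^ 2 := by positivity
  rw [cutoffDeriv, max_eq_left hm, abs_le]
  constructor <;> linarith

theorem abs_cutoffDeriv₂_le {t : ℝ} (h₀ : 0 ≤ t) : |cutoffDeriv₂ t| ≤ 20 := by
  rcases le_total 1 t with h₁ | h₁
  · simp [cutoffDeriv₂_of_one_le h₁]
  have hm : 0 ≤ 1 - t := sub_nonneg.2 h₁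
  have hm' : 1 - t ≤ 1 := by linarith
  have h₂ : (1 - t) ^ 3 ≤ 1 := pow_le_one₀ hm hm'
  have h₃ : t * (1 - t) ^ 2 ≤ 1 := mul_le_one₀ h₁ (by positivity) (pow_le_one₀ hm hm')
  have h₄ : t ^ 2 * (1 - t) ≤ 1 := mul_le_one₀ (pow_le_one₀ h₀ h₁) hm hm'
  have h₅ : 0 ≤ (1 - t) ^ 3 := by positivity
  have h₆ : 0 ≤ t * (1 - t) ^ 2 := by positivity
  have h₇ : 0 ≤ t ^ 2 * (1 - t) := by positivity
  rw [cutoffDeriv₂, max_eq_left hm, abs_le]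
  constructor <;> linarith

/-- A monotone `C²` function on a convex set `s` lying on one side of `c` (the side given by
the sign of `h`) can be modified within distance `|h|` of `c` so that its second derivative
vanishes at `c`, keeping its value and derivative at `c`. -/
theorem exists_flatten_at {s : Set ℝ} (hs : Convex ℝ s) {c h M : ℝ} (hc : c ∈ s) (hh : h ≠ 0)
    (hside : ∀ x ∈ s, 0 ≤ (x - c) / h) {F F' F'' : ℝ → ℝ}
    (hF : ∀ x ∈ s, HasDerivWithinAt F (F' x) s x)
    (hF' : ∀ x ∈ s, HasDerivWithinAt F' (F'' x) s x)
    (hF'' : ContinuousOn F'' s) (hpos : ∀ x ∈ s, 0 ≤ F' x) (hM : ∀ x ∈ s, |F'' x| ≤ M)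
    (hsmall : 4 * M * |h| ≤ F' c) :
    ∃ G G' G'' : ℝ → ℝ,
      (∀ x ∈ s, HasDerivWithinAt G (G' x) s x) ∧
      (∀ x ∈ s, HasDerivWithinAt G' (G'' x) s x) ∧
      ContinuousOn G'' s ∧
      (∀ x, 1 ≤ (x - c) / h → G x = F x) ∧
      G c = F c ∧ G' c = F' c ∧ G'' c = 0 ∧
      (∀ x ∈ s, 0 ≤ G' x) ∧ (∀ x ∈ s, |G'' x| ≤ 11 * M) := by
  have hM₀ : 0 ≤ M := (abs_nonneg _).trans (hM c hc)
  have hlin : ∀ x, HasDerivAt (fun y => (y - c) / h) (1 / h) x := fun x =>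
    ((hasDerivAt_id x).sub_const c).div_const h
  refine ⟨fun x => F x - F'' c / 2 * h ^ 2 * cutoff ((x - c) / h),
    fun x => F' x - F'' c / 2 * h * cutoffDeriv ((x - c) / h),
    fun x => F'' x - F'' c / 2 * cutoffDeriv₂ ((x - c) / h),
    fun x hx => ?_, fun x hx => ?_, ?_, fun x hx => ?_, ?_, ?_, ?_, fun x hx => ?_,
    fun x hx => ?_⟩
  · have h₁ := ((hasDerivAt_cutoff ((x - c) / h)).comp x (hlin x)).const_mul (F'' c / 2 * h ^ 2)
    refine ((hF x hx).sub h₁.hasDerivWithinAt).congr_deriv ?_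
    field_simp
  · have h₁ := ((hasDerivAt_cutoffDeriv ((x - c) / h)).comp x (hlin x)).const_mul (F'' c / 2 * h)
    refine ((hF' x hx).sub h₁.hasDerivWithinAt).congr_deriv ?_
    field_simp
  · have h₁ : Continuous fun x => F'' c / 2 * cutoffDeriv₂ ((x - c) / h) :=
      continuous_const.mul (continuous_cutoffDeriv₂.comp (by fun_prop))
    exact hF''.sub h₁.continuousOn
  · simp [cutoff_of_one_le hx]
  · simp [cutoff]
  · simp [cutoffDeriv]
  · simp [cutoffDeriv₂]
  · rcases le_total 1 ((x - c) / h) with h₁ | h₁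
    · simpa [cutoffDeriv_of_one_le h₁] using hpos x hx
    have hlip : |F' x - F' c| ≤ M * |x - c| :=
      hs.norm_image_sub_le_of_norm_hasDerivWithin_le hF' hM hc hx
    have hxc : |x - c| ≤ |h| := by
      have h₂ : |(x - c) / h| ≤ 1 := by rwa [abs_of_nonneg (hside x hx)]
      rwa [abs_div, div_le_one (abs_pos.2 hh)] at h₂
    have hcorr : |F'' c / 2 * h * cutoffDeriv ((x - c) / h)| ≤ M / 2 * |h| * 5 := by
      rw [abs_mul, abs_mul, abs_div, abs_two]
      gcongr
      · exact hM c hc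
      · exact abs_cutoffDeriv_le (hside x hx) h₁
    have hMh : M * |x - c| ≤ M * |h| := by gcongr
    have := (abs_le.1 hlip).1
    have := (abs_le.1 hcorr).2
    have : 0 ≤ M * |h| := by positivity
    simp only [sub_nonneg]
    linarith
  · have hcorr : |F'' c / 2 * cutoffDeriv₂ ((x - c) / h)| ≤ M / 2 * 20 := by
      rw [abs_mul, abs_div, abs_two]
      gcongr
      · exact hM c hc
      · exact abs_cutoffDeriv₂_le (hside x hx)
    have := abs_sub (F'' x) (F'' c / 2 * cutoffDeriv₂ ((x - c) / h))
    have := hM x hx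
    simp only
    linarith

theorem eqOn_ite_le_right {f g : ℝ → ℝ} {b c : ℝ} (hfg : f b = g b) :
    EqOn (fun x => if x ≤ b then f x else g x) g (Icc b c) := by
  intro x hx
  rcases hx.1.eq_or_lt with rfl | h
  · simp [hfg]
  · simp [not_le.2 h]

theorem eqOn_ite_le_left {f g : ℝ → ℝ} {a b : ℝ} :
    EqOn (fun x => if x ≤ b then f x else g x) f (Icc a b) :=
  fun _ hx => if_pos hx.2

/-- Gluing two differentiable functions along a common endpoint. -/
theorem hasDerivWithinAt_ite_le {f f' g g' : ℝ → ℝ} {a b c : ℝ} (hab : a ≤ b) (hbc : b ≤ c)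
    (hf : ∀ x ∈ Icc a b, HasDerivWithinAt f (f' x) (Icc a b) x)
    (hg : ∀ x ∈ Icc b c, HasDerivWithinAt g (g' x) (Icc b c) x)
    (hfg : f b = g b) (hfg' : f' b = g' b) :
    ∀ x ∈ Icc a c, HasDerivWithinAt (fun x => if x ≤ b then f x else g x)
      ((fun x => if x ≤ b then f' x else g' x) x) (Icc a c) x := by
  intro x _
  rw [← Icc_union_Icc_eq_Icc hab hbc]
  refine HasDerivWithinAt.union ?_ ?_
  · by_cases hx : x ∈ Icc a b
    · rw [eqOn_ite_le_left hx]
      exact (hf x hx).congr_of_mem eqOn_ite_le_left hx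
    · exact HasFDerivWithinAt.of_notMem_closure (by rwa [isClosed_Icc.closure_eq])
  · by_cases hx : x ∈ Icc b c
    · rw [eqOn_ite_le_right hfg' hx]
      exact (hg x hx).congr_of_mem (eqOn_ite_le_right hfg) hx
    · exact HasFDerivWithinAt.of_notMem_closure (by rwa [isClosed_Icc.closure_eq])

/-- Gluing two continuous functions along a common endpoint. -/
theorem continuousOn_ite_le {f g : ℝ → ℝ} {a b c : ℝ} (hab : a ≤ b) (hbc : b ≤ c)
    (hf : ContinuousOn f (Icc a b)) (hg : ContinuousOn g (Icc b c)) (hfg : f b = g b) :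
    ContinuousOn (fun x => if x ≤ b then f x else g x) (Icc a c) := by
  rw [← Icc_union_Icc_eq_Icc hab hbc]
  exact (hf.congr eqOn_ite_le_left).union_of_isClosed (hg.congr (eqOn_ite_le_right hfg))
    isClosed_Icc isClosed_Icc


/-- Local `C²` patching: two monotone `C²` pieces with matching value and positive
matching first derivative at an interior node, each with second derivative bounded
by `M`, can be glued into a single monotone `C²` function agreeing with the pieces
away from a `δ`-neighborhood of the node, passing through the prescribed value at
the node, with second derivative bounded by a universal constant times `M`. -/
theorem local_C2_patching :
    ∃ c₀ C₀ : ℝ, 0 < c₀ ∧ 0 < C₀ ∧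
      ∀ (x₁ x₂ x₃ M d f₂ : ℝ) (Fm Fm' Fm'' Fp Fp' Fp'' : ℝ → ℝ),
        x₁ < x₂ → x₂ < x₃ → 0 < M → 0 < d →
        (∀ x ∈ Set.Icc x₁ x₂, HasDerivWithinAt Fm (Fm' x) (Set.Icc x₁ x₂) x) →
        (∀ x ∈ Set.Icc x₁ x₂, HasDerivWithinAt Fm' (Fm'' x) (Set.Icc x₁ x₂) x) →
        ContinuousOn Fm'' (Set.Icc x₁ x₂) →
        (∀ x ∈ Set.Icc x₂ x₃, HasDerivWithinAt Fp (Fp' x) (Set.Icc x₂ x₃) x) →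
        (∀ x ∈ Set.Icc x₂ x₃, HasDerivWithinAt Fp' (Fp'' x) (Set.Icc x₂ x₃) x) →
        ContinuousOn Fp'' (Set.Icc x₂ x₃) →
        Fm x₂ = f₂ → Fp x₂ = f₂ → Fm' x₂ = d → Fp' x₂ = d →
        (∀ x ∈ Set.Icc x₁ x₂, 0 ≤ Fm' x) → (∀ x ∈ Set.Icc x₂ x₃, 0 ≤ Fp' x) →
        (∀ x ∈ Set.Icc x₁ x₂, |Fm'' x| ≤ M) → (∀ x ∈ Set.Icc x₂ x₃, |Fp'' x| ≤ M) →
        ∀ δ : ℝ, 0 < δ →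
          δ ≤ min (min ((x₂ - x₁) / 2) ((x₃ - x₂) / 2)) (c₀ * d / M) →
          ∃ Ft Ft' Ft'' : ℝ → ℝ,
            (∀ x ∈ Set.Icc x₁ x₃, HasDerivWithinAt Ft (Ft' x) (Set.Icc x₁ x₃) x) ∧
            (∀ x ∈ Set.Icc x₁ x₃, HasDerivWithinAt Ft' (Ft'' x) (Set.Icc x₁ x₃) x) ∧
            ContinuousOn Ft'' (Set.Icc x₁ x₃) ∧
            (∀ x ∈ Set.Icc x₁ (x₂ - δ), Ft x = Fm x) ∧
            (∀ x ∈ Set.Icc (x₂ + δ) x₃, Ft x = Fp x) ∧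
            Ft x₂ = f₂ ∧
            (∀ x ∈ Set.Icc x₁ x₃, 0 ≤ Ft' x) ∧
            (∀ x ∈ Set.Icc x₁ x₃, |Ft'' x| ≤ C₀ * M) := by
  refine ⟨1 / 4, 11, by norm_num, by norm_num, ?_⟩
  intro x₁ x₂ x₃ M d f₂ Fm Fm' Fm'' Fp Fp' Fp'' h₁₂ h₂₃ hM hd hFm hFm' hFm'' hFp hFp' hFp''
    hm₂ hp₂ hm₂' hp₂' hmpos hppos hmM hpM δ hδ hδle
  have hδd : 4 * M * |δ| ≤ d := by
    have h := (le_div_iff₀ hM).1 (hδle.trans (min_le_right _ _))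
    rw [abs_of_pos hδ]
    linarith
  obtain ⟨G, G', G'', hG, hG', hG'', hGF, hG₂, hG₂', hG₂'', hGpos, hGM⟩ :=
    exists_flatten_at (convex_Icc x₁ x₂) (right_mem_Icc.2 h₁₂.le) (neg_ne_zero.2 hδ.ne')
      (fun x hx => div_nonneg_of_nonpos (sub_nonpos.2 hx.2) (neg_nonpos.2 hδ.le))
      hFm hFm' hFm'' hmpos hmM (by rwa [abs_neg, hm₂'])
  obtain ⟨H, H', H'', hH, hH', hH'', hHF, hH₂, hH₂', hH₂'', hHpos, hHM⟩ :=
    exists_flatten_at (convex_Icc x₂ x₃) (left_mem_Icc.2 h₂₃.le) hδ.ne'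
      (fun x hx => div_nonneg (sub_nonneg.2 hx.1) hδ.le)
      hFp hFp' hFp'' hppos hpM (by rwa [hp₂'])
  have hGH : G x₂ = H x₂ := by rw [hG₂, hH₂, hm₂, hp₂]
  have hGH' : G' x₂ = H' x₂ := by rw [hG₂', hH₂', hm₂', hp₂']
  have hGH'' : G'' x₂ = H'' x₂ := by rw [hG₂'', hH₂'']
  refine ⟨fun x => if x ≤ x₂ then G x else H x, fun x => if x ≤ x₂ then G' x else H' x,
    fun x => if x ≤ x₂ then G'' x else H'' x,
    hasDerivWithinAt_ite_le h₁₂.le h₂₃.le hG hH hGH hGH',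
    hasDerivWithinAt_ite_le h₁₂.le h₂₃.le hG' hH' hGH' hGH'',
    continuousOn_ite_le h₁₂.le h₂₃.le hG'' hH'' hGH'',
    fun x hx => ?_, fun x hx => ?_, ?_, fun x hx => ?_, fun x hx => ?_⟩
  · have hx₂ : x ≤ x₂ := by linarith [hx.2]
    simp only [if_pos hx₂]
    refine hGF x ?_
    rw [le_div_iff_of_neg (neg_lt_zero.2 hδ)]
    linarith [hx.2]
  · have hx₂ : ¬ x ≤ x₂ := by linarith [hx.1]
    simp only [if_neg hx₂]
    refine hHF x ?_
    rw [le_div_iff₀ hδ]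
    linarith [hx.1]
  · simp [hG₂, hm₂]
  · dsimp only
    split_ifs with h
    · exact hGpos x ⟨hx.1, h⟩
    · exact hHpos x ⟨(not_le.1 h).le, hx.2⟩
  · dsimp only
    split_ifs with h
    · exact hGM x ⟨hx.1, h⟩
    · exact hHM x ⟨(not_le.1 h).le, hx.2⟩
end

section
/- Let a, b ≥ 0 and c ≥ max{a, b}. Define φ(x) := 1 − 3x² + 2x³ and F(x) := (a x)·φ(x) + (1 − φ(x))·(b(x−1) + c) for x ∈ [0,1]. Then F is infinitely differentiable on [0,1], F(0) = 0, F(1) = c, F'(0) = a, F'(1) = b, and F'(x) ≥ 0 for all x ∈ [0,1]. -/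
/-- The Whitney-type extension `F(x) = (ax)φ(x) + (1-φ(x))(b(x-1)+c)` with cutoff
`φ(x) = 1 - 3x² + 2x³` is a smooth monotone Hermite interpolant when `c ≥ max{a,b}`. -/
theorem whitney_extension_monotone
    (a b c : ℝ) (ha : 0 ≤ a) (hb : 0 ≤ b) (hc : max a b ≤ c)
    (φ F : ℝ → ℝ)
    (hφ : ∀ x, φ x = 1 - 3 * x ^ 2 + 2 * x ^ 3)
    (hF : ∀ x, F x = (a * x) * φ x + (1 - φ x) * (b * (x - 1) + c)) :
    ContDiffOn ℝ (⊤ : ℕ∞) F (Set.Icc 0 1) ∧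
    F 0 = 0 ∧ F 1 = c ∧ deriv F 0 = a ∧ deriv F 1 = b ∧
    ∀ x ∈ Set.Icc (0:ℝ) 1, 0 ≤ deriv F x := by
  obtain rfl : φ = fun x => 1 - 3 * x ^ 2 + 2 * x ^ 3 := funext hφ
  obtain rfl := funext hF
  have hderiv : ∀ x : ℝ, deriv (fun x : ℝ => (a * x) * (1 - 3 * x ^ 2 + 2 * x ^ 3) +
      (1 - (1 - 3 * x ^ 2 + 2 * x ^ 3)) * (b * (x - 1) + c)) x =
      a * ((1 - x) ^ 2 * (1 + 2 * x)) + b * (x ^ 2 * (3 - 2 * x)) +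
        6 * (x * (1 - x)) * (c - b * (1 - x) - a * x) := by
    intro x
    have hcut : HasDerivAt (fun x : ℝ => 1 - 3 * x ^ 2 + 2 * x ^ 3)
        (-(3 * (2 * x)) + 2 * (3 * x ^ 2)) x := by
      refine ((((hasDerivAt_pow 2 x).const_mul 3).const_sub 1).add
        ((hasDerivAt_pow 3 x).const_mul 2)).congr_deriv ?_
      norm_num
    have hline₀ := (hasDerivAt_id' x).const_mul a
    have hline₁ := (((hasDerivAt_id' x).sub_const 1).const_mul b).add_const c
    refine ((hline₀.mul hcut).add ((hcut.const_sub 1).mul hline₁)).deriv.trans ?_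
    ring
  refine ⟨by fun_prop, by norm_num, by norm_num, ?_, ?_, ?_⟩
  · rw [hderiv]; ring
  · rw [hderiv]; ring
  · rintro x ⟨hx₀, hx₁⟩
    rw [hderiv]
    have hx : 0 ≤ 1 - x := by linarith
    have hx' : 0 ≤ 3 - 2 * x := by linarith
    have hgap : 0 ≤ c - b * (1 - x) - a * x := by
      linarith [mul_le_mul_of_nonneg_right ((le_max_left a b).trans hc) hx₀,
        mul_le_mul_of_nonneg_right ((le_max_right a b).trans hc) hx]
    positivity
end

section
/- Let a, b ≥ 0 and c ≥ max{a, b}. Define φ(x) := 1 − 3x² + 2x³ and F(x) := (a x)·φ(x) + (1 − φ(x))·(b(x−1) + c) for x ∈ [0,1]. Then for every x ∈ [0,1], |F''(x)| ≤ 6·[ (2c − a − b) + √((2c − a − b)² + (b − a)²) ]. -/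
/-- Curvature bound for the Whitney-type extension: for `c ≥ max{a,b}` one has
`|F''(x)| ≤ 6 M*(a,b,c)` on `[0,1]`, where
`M*(a,b,c) = (2c - a - b) + √((2c - a - b)² + (b - a)²)` in this regime. -/
theorem whitney_extension_curvature_bound
    (a b c : ℝ) (ha : 0 ≤ a) (hb : 0 ≤ b) (hc : max a b ≤ c)
    (φ F : ℝ → ℝ)
    (hφ : ∀ x, φ x = 1 - 3 * x ^ 2 + 2 * x ^ 3)
    (hF : ∀ x, F x = (a * x) * φ x + (1 - φ x) * (b * (x - 1) + c)) :
    ∀ x ∈ Set.Icc (0:ℝ) 1,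
      |deriv (deriv F) x| ≤
        6 * ((2 * c - a - b) + Real.sqrt ((2 * c - a - b) ^ 2 + (b - a) ^ 2)) := by
  intro x hx
  obtain ⟨hx0, hx1⟩ := hx
  have hpa : 0 ≤ c - a := sub_nonneg.2 ((le_max_left a b).trans hc)
  have hpb : 0 ≤ c - b := sub_nonneg.2 ((le_max_right a b).trans hc)
  have hFpoly : F = fun y ↦ a * y + 3 * (c - b) * y ^ 2
      + (3 * (b - a) - 2 * (c - b)) * y ^ 3 - 2 * (b - a) * y ^ 4 := by
    funext y
    rw [hF, hφ]
    ring
  have hF' : deriv F = fun y ↦ a + 6 * (c - b) * y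
      + 3 * (3 * (b - a) - 2 * (c - b)) * y ^ 2 - 8 * (b - a) * y ^ 3 := by
    funext y
    rw [hFpoly]
    refine (HasDerivAt.congr_deriv (((((hasDerivAt_id' y).const_mul a).add
      ((hasDerivAt_pow 2 y).const_mul (3 * (c - b)))).add
      ((hasDerivAt_pow 3 y).const_mul (3 * (b - a) - 2 * (c - b)))).sub
      ((hasDerivAt_pow 4 y).const_mul (2 * (b - a)))) ?_).deriv
    norm_num
    ring
  have hF'' : deriv (deriv F) x
      = 6 * ((c - b) * ((1 - x) * (1 - 4 * x)) + (c - a) * (x * (3 - 4 * x))) := by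
    rw [hF']
    refine (HasDerivAt.congr_deriv (((((hasDerivAt_id' x).const_mul (6 * (c - b))).const_add a).add
      ((hasDerivAt_pow 2 x).const_mul (3 * (3 * (b - a) - 2 * (c - b))))).sub
      ((hasDerivAt_pow 3 x).const_mul (8 * (b - a)))) ?_).deriv
    norm_num
    ring
  have hb_coeff : |(1 - x) * (1 - 4 * x)| ≤ 1 :=
    abs_le.2 ⟨by nlinarith [sq_nonneg (8 * x - 5)], by nlinarith⟩
  have ha_coeff : |x * (3 - 4 * x)| ≤ 1 :=
    abs_le.2 ⟨by nlinarith, by nlinarith [sq_nonneg (8 * x - 3)]⟩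
  have hsum : |(c - b) * ((1 - x) * (1 - 4 * x)) + (c - a) * (x * (3 - 4 * x))|
      ≤ (c - b) + (c - a) := by
    refine (abs_add_le _ _).trans (add_le_add ?_ ?_)
    · rw [abs_mul, abs_of_nonneg hpb]
      exact mul_le_of_le_one_right hpb hb_coeff
    · rw [abs_mul, abs_of_nonneg hpa]
      exact mul_le_of_le_one_right hpa ha_coeff
  rw [hF'', abs_mul, abs_of_pos (by norm_num : (0 : ℝ) < 6)]
  linarith [Real.sqrt_nonneg ((2 * c - a - b) ^ 2 + (b - a) ^ 2)]
end

section
/- Let 0 ≤ a < c < b, set T := (b − c)/(b − a) and m := aT, and define x(t) := 3T·t(1−t) + t³ and y(t) := 3m·t(1−t) + c·t³ for t ∈ [0,1]. Then there exists a function G : [0,1] → ℝ, twice continuously differentiable on [0,1], such that G(x(t)) = y(t) for all t ∈ [0,1], G(0) = 0, G(1) = c, G'(0) = a, G'(1) = b, G'(x) ≥ 0 for all x ∈ [0,1], and G''(x(T)) = (2/3)·(b − a)³ / ((b − c)(c − a)). In particular, sup_{x ∈ [0,1]} |G''(x)| ≥ (2/3)·(b − a)³ / ((b − c)(c − a)).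 -/
/-- A real function whose derivative is everywhere positive and which is unbounded in both
directions has a global inverse, differentiable with the reciprocal derivative. -/
theorem exists_inverse_hasDerivAt {f f' : ℝ → ℝ} (hf : ∀ t, HasDerivAt f (f' t) t)
    (hpos : ∀ t, 0 < f' t) (htop : Filter.Tendsto f Filter.atTop Filter.atTop)
    (hbot : Filter.Tendsto f Filter.atBot Filter.atBot) :
    ∃ s : ℝ → ℝ, StrictMono f ∧ (∀ t, s (f t) = t) ∧ Continuous s ∧
      ∀ u, HasDerivAt s (f' (s u))⁻¹ u := by
  have hmono : StrictMono f := strictMono_of_hasDerivAt_pos hf hpos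
  have hcont : Continuous f := continuous_iff_continuousAt.2 fun t => (hf t).continuousAt
  let e : ℝ ≃o ℝ := hmono.orderIsoOfSurjective f (hcont.surjective htop hbot)
  have he : ∀ u, f (e.symm u) = u := e.apply_symm_apply
  refine ⟨e.symm, hmono, e.symm_apply_apply, e.symm.continuous, fun u => ?_⟩
  exact HasDerivAt.of_local_left_inverse e.symm.continuous.continuousAt (hf _)
    (hpos _).ne' (Filter.Eventually.of_forall he)

/-- The cubic `3 T t (1 - t) + t³` with `0 < T < 1` has a global differentiable inverse. -/
theorem exists_inverse_cubic {T : ℝ} (hT0 : 0 < T) (hT1 : T < 1) {x : ℝ → ℝ}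
    (hx : ∀ t, x t = 3 * T * (t * (1 - t)) + t ^ 3) :
    ∃ s : ℝ → ℝ, StrictMono x ∧ (∀ t, s (x t) = t) ∧ Continuous s ∧
      ∀ u, HasDerivAt s (3 * (T - 2 * T * s u + s u ^ 2))⁻¹ u := by
  have hk : 0 < 3 * (T * (1 - T)) := by
    have := mul_pos hT0 (sub_pos.2 hT1)
    positivity
  have hq : ∀ t : ℝ, 0 ≤ t ^ 2 - 3 * T * t + 3 * T ^ 2 := fun t => by
    nlinarith [sq_nonneg (2 * t - 3 * T), sq_nonneg T]
  have hsplit : ∀ t, x t = 3 * (T * (1 - T)) * t + t * (t ^ 2 - 3 * T * t + 3 * T ^ 2) :=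
    fun t => by rw [hx]; ring
  refine exists_inverse_hasDerivAt (f' := fun t => 3 * (T - 2 * T * t + t ^ 2)) (fun t => ?_)
    (fun t => by nlinarith [sq_nonneg (t - T)]) ?_ ?_
  · rw [funext hx]
    have h := (((hasDerivAt_id t).mul ((hasDerivAt_id t).const_sub 1)).const_mul (3 * T)).add
      ((hasDerivAt_id t).pow 3)
    refine h.congr_deriv ?_
    simp only [id]
    push_cast
    ring
  · refine Filter.tendsto_atTop_mono' _ ?_ (Filter.tendsto_id.const_mul_atTop hk)
    filter_upwards [Filter.eventually_ge_atTop 0] with t ht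
    rw [hsplit]
    exact le_add_of_nonneg_right (mul_nonneg ht (hq t))
  · refine Filter.tendsto_atBot_mono' _ ?_ (Filter.tendsto_id.const_mul_atBot hk)
    filter_upwards [Filter.eventually_le_atBot 0] with t ht
    rw [hsplit]
    exact add_le_of_nonpos_right (mul_nonpos_of_nonpos_of_nonneg ht (hq t))


/-- The cubic Bézier curve with control points `(0,0), (T,m), (T,m), (1,c)` is the graph
of a `C²` monotone Hermite interpolant `G`, whose second derivative at `x(T)` equals
`(2/3)(b-a)³/((b-c)(c-a))`; in particular `sup |G''| ≥ (2/3)(b-a)³/((b-c)(c-a))`. -/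
theorem bezier_graph_interpolant
    (a b c T m : ℝ) (ha : 0 ≤ a) (hac : a < c) (hcb : c < b)
    (hT : T = (b - c) / (b - a)) (hm : m = a * T)
    (x y : ℝ → ℝ)
    (hx : ∀ t, x t = 3 * T * (t * (1 - t)) + t ^ 3)
    (hy : ∀ t, y t = 3 * m * (t * (1 - t)) + c * t ^ 3) :
    ∃ G g g2 : ℝ → ℝ,
      (∀ u ∈ Set.Icc (0:ℝ) 1, HasDerivWithinAt G (g u) (Set.Icc (0:ℝ) 1) u) ∧
      (∀ u ∈ Set.Icc (0:ℝ) 1, HasDerivWithinAt g (g2 u) (Set.Icc (0:ℝ) 1) u) ∧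
      ContinuousOn g2 (Set.Icc (0:ℝ) 1) ∧
      (∀ t ∈ Set.Icc (0:ℝ) 1, G (x t) = y t) ∧
      G 0 = 0 ∧ G 1 = c ∧ g 0 = a ∧ g 1 = b ∧
      (∀ u ∈ Set.Icc (0:ℝ) 1, 0 ≤ g u) ∧
      g2 (x T) = 2 / 3 * (b - a) ^ 3 / ((b - c) * (c - a)) ∧
      2 / 3 * (b - a) ^ 3 / ((b - c) * (c - a)) ≤
        sSup ((fun u => |g2 u|) '' Set.Icc (0:ℝ) 1) := by
  have hca : 0 < c - a := sub_pos.2 hac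
  have hbc : 0 < b - c := sub_pos.2 hcb
  have hba : 0 < b - a := by linarith
  have hT0 : 0 < T := hT ▸ div_pos hbc hba
  have hT1' : 1 - T = (c - a) / (b - a) := by rw [hT]; field_simp; ring
  have hT1 : 0 < 1 - T := hT1' ▸ div_pos hca hba
  obtain ⟨s, hmono, hsx, hs, hs'⟩ := exists_inverse_cubic hT0 (sub_pos.1 hT1) hx
  have hD : ∀ t : ℝ, 0 < T - 2 * T * t + t ^ 2 := fun t => by
    nlinarith [sq_nonneg (t - T), mul_pos hT0 hT1]
  have hx0 : x 0 = 0 := by rw [hx]; ring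
  have hx1 : x 1 = 1 := by rw [hx]; ring
  have hs0 : s 0 = 0 := by simpa [hx0] using hsx 0
  have hs1 : s 1 = 1 := by simpa [hx1] using hsx 1
  let p : ℝ → ℝ := fun t => a + (c - a) * t ^ 2 / (T - 2 * T * t + t ^ 2)
  let q : ℝ → ℝ := fun t => 2 * T * (c - a) * (t * (1 - t)) / (3 * (T - 2 * T * t + t ^ 2) ^ 3)
  have hy' : ∀ t, HasDerivAt y (3 * (m - 2 * m * t + c * t ^ 2)) t := fun t => by
    rw [funext hy]
    have h := (((hasDerivAt_id t).mul ((hasDerivAt_id t).const_sub 1)).const_mul (3 * m)).add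
      (((hasDerivAt_id t).pow 3).const_mul c)
    refine h.congr_deriv ?_
    simp only [id]
    push_cast
    ring
  have hp' : ∀ t, HasDerivAt p
      (2 * T * (c - a) * (t * (1 - t)) / (T - 2 * T * t + t ^ 2) ^ 2) t := fun t => by
    have hDt := (hD t).ne'
    have h := ((((hasDerivAt_id t).pow 2).const_mul (c - a)).div
      ((((hasDerivAt_id t).const_mul (2 * T)).const_sub T).add ((hasDerivAt_id t).pow 2))
      hDt).const_add a
    refine h.congr_deriv ?_
    simp only [id, Pi.pow_apply, Pi.add_apply]
    push_cast
    congr 1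
    ring
  have hq : Continuous q := by
    refine Continuous.div (by fun_prop) (by fun_prop) fun t => ?_
    have := hD t
    positivity
  have hval : q T = 2 / 3 * (b - a) ^ 3 / ((b - c) * (c - a)) := by
    have hDT : T - 2 * T * T + T ^ 2 = T * (1 - T) := by ring
    simp only [q, hDT]
    rw [hT1', hT]
    field_simp
  have hqs : Continuous fun u => q (s u) := hq.comp hs
  refine ⟨fun u => y (s u), fun u => p (s u), fun u => q (s u), fun u _ => ?_, fun u _ => ?_,
    hqs.continuousOn, fun t _ => by simp only [hsx], ?_, ?_, ?_, ?_, fun u _ => ?_, ?_, ?_⟩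
  · refine (((hy' (s u)).comp u (hs' u)).congr_deriv ?_).hasDerivWithinAt
    have hDu := (hD (s u)).ne'
    simp only [p, hm]
    generalize hd : T - 2 * T * s u + s u ^ 2 = d at hDu ⊢
    field_simp
    rw [← hd]
    ring
  · refine (((hp' (s u)).comp u (hs' u)).congr_deriv ?_).hasDerivWithinAt
    have := (hD (s u)).ne'
    simp only [q]
    field_simp
  · simp only [hs0, hy]; ring
  · simp only [hs1, hy]; ring
  · simp [p, hs0]
  · have h1 : T - 2 * T * 1 + 1 ^ 2 = 1 - T := by ring
    simp only [p, hs1, h1]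
    rw [hT1']
    field_simp
    ring
  · have := hD (s u)
    simp only [p]
    positivity
  · simp only [hsx, hval]
  · have hmem : x T ∈ Set.Icc (0 : ℝ) 1 :=
      ⟨hx0 ▸ hmono.monotone hT0.le, hx1 ▸ hmono.monotone (sub_pos.1 hT1).le⟩
    calc 2 / 3 * (b - a) ^ 3 / ((b - c) * (c - a)) = q (s (x T)) := by rw [hsx, hval]
      _ ≤ |q (s (x T))| := le_abs_self _
      _ ≤ _ := le_csSup (isCompact_Icc.bddAbove_image hqs.abs.continuousOn)
        (Set.mem_image_of_mem _ hmem)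
end

section
/- Let a, b, c ≥ 0 and λ > 0 satisfy λ·|b − a| ≤ a + b and |c − (a + b)/2| ≤ (λ/4)·|b − a|. Then there exist real numbers m₁, m₂ ≥ 0 with |m₁ − a| ≤ λ·|b − a| and |m₂ − b| ≤ λ·|b − a| such that the function G(t) := ∫₀ᵗ [ a(1−τ)³ + 3m₁·τ(1−τ)² + 3m₂·τ²(1−τ) + b·τ³ ] dτ satisfies: G(0) = 0, G(1) = c, G'(0) = a, G'(1) = b, G'(t) ≥ 0 for all t ∈ [0,1], and |G''(t)| ≤ 3(2λ + 1)·|b − a| for all t ∈ [0,1]. -/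
/-- The cubic with Bernstein coefficients `m₀, m₁, m₂, m₃`. -/
def bernsteinCubic (m₀ m₁ m₂ m₃ t : ℝ) : ℝ :=
  m₀ * (1 - t) ^ 3 + 3 * m₁ * (t * (1 - t) ^ 2) + 3 * m₂ * (t ^ 2 * (1 - t)) + m₃ * t ^ 3

theorem continuous_bernsteinCubic (m₀ m₁ m₂ m₃ : ℝ) :
    Continuous (bernsteinCubic m₀ m₁ m₂ m₃) := by
  unfold bernsteinCubic
  fun_prop

theorem bernsteinCubic_nonneg {m₀ m₁ m₂ m₃ t : ℝ} (h₀ : 0 ≤ m₀) (h₁ : 0 ≤ m₁) (h₂ : 0 ≤ m₂)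
    (h₃ : 0 ≤ m₃) (ht : t ∈ Set.Icc (0 : ℝ) 1) : 0 ≤ bernsteinCubic m₀ m₁ m₂ m₃ t := by
  have ht₀ : 0 ≤ t := ht.1
  have ht₁ : 0 ≤ 1 - t := sub_nonneg.2 ht.2
  unfold bernsteinCubic
  positivity

theorem hasDerivAt_bernsteinCubic (m₀ m₁ m₂ m₃ t : ℝ) :
    HasDerivAt (bernsteinCubic m₀ m₁ m₂ m₃)
      (3 * ((m₁ - m₀) * (1 - t) ^ 2 + (m₂ - m₁) * (2 * (t * (1 - t))) + (m₃ - m₂) * t ^ 2)) t := by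
  have hid := hasDerivAt_id' t
  have hsub := hid.const_sub 1
  refine HasDerivAt.congr_deriv (f := bernsteinCubic m₀ m₁ m₂ m₃) (((((hsub.pow 3).const_mul m₀).add ((hid.mul (hsub.pow 2)).const_mul (3 * m₁))).add
    (((hid.pow 2).mul hsub).const_mul (3 * m₂))).add ((hid.pow 3).const_mul m₃)) ?_
  simp
  ring

theorem abs_deriv_bernsteinCubic_le {m₀ m₁ m₂ m₃ t K : ℝ} (h₁ : |m₁ - m₀| ≤ K)
    (h₂ : |m₂ - m₁| ≤ K) (h₃ : |m₃ - m₂| ≤ K) (ht : t ∈ Set.Icc (0 : ℝ) 1) :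
    |deriv (bernsteinCubic m₀ m₁ m₂ m₃) t| ≤ 3 * K := by
  have ht₀ : 0 ≤ t := ht.1
  have ht₁ : 0 ≤ 1 - t := sub_nonneg.2 ht.2
  have hw₁ : 0 ≤ (1 - t) ^ 2 := by positivity
  have hw₂ : 0 ≤ 2 * (t * (1 - t)) := by positivity
  have hw₃ : 0 ≤ t ^ 2 := by positivity
  rw [abs_le] at h₁ h₂ h₃
  rw [(hasDerivAt_bernsteinCubic m₀ m₁ m₂ m₃ t).deriv, abs_le]
  constructor
  · linear_combination 3 * mul_le_mul_of_nonneg_right h₁.1 hw₁ +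
      3 * mul_le_mul_of_nonneg_right h₂.1 hw₂ + 3 * mul_le_mul_of_nonneg_right h₃.1 hw₃
  · linear_combination 3 * mul_le_mul_of_nonneg_right h₁.2 hw₁ +
      3 * mul_le_mul_of_nonneg_right h₂.2 hw₂ + 3 * mul_le_mul_of_nonneg_right h₃.2 hw₃

theorem integral_bernsteinCubic (m₀ m₁ m₂ m₃ : ℝ) :
    ∫ t in (0 : ℝ)..1, bernsteinCubic m₀ m₁ m₂ m₃ t = (m₀ + m₁ + m₂ + m₃) / 4 := by
  have hF (t : ℝ) : HasDerivAt (fun t : ℝ ↦ m₀ * t + 3 * (m₁ - m₀) / 2 * t ^ 2 +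
      (m₀ - 2 * m₁ + m₂) * t ^ 3 + (m₃ - 3 * m₂ + 3 * m₁ - m₀) / 4 * t ^ 4)
      (bernsteinCubic m₀ m₁ m₂ m₃ t) t := by
    refine HasDerivAt.congr_deriv (((((hasDerivAt_id' t).const_mul m₀).add
      ((hasDerivAt_pow 2 t).const_mul (3 * (m₁ - m₀) / 2))).add
      ((hasDerivAt_pow 3 t).const_mul (m₀ - 2 * m₁ + m₂))).add
      ((hasDerivAt_pow 4 t).const_mul ((m₃ - 3 * m₂ + 3 * m₁ - m₀) / 4))) ?_
    simp [bernsteinCubic]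
    ring
  rw [intervalIntegral.integral_eq_sub_of_hasDerivAt (fun t _ ↦ hF t)
    ((continuous_bernsteinCubic m₀ m₁ m₂ m₃).intervalIntegrable 0 1)]
  ring

/-- A number `e ≥ -(a + b)` splits as `x + y` with `x ≥ -a`, `y ≥ -b` and both parts bounded
by `|e|`. -/
theorem exists_add_eq_of_neg_add_le {a b e : ℝ} (ha : 0 ≤ a) (hb : 0 ≤ b) (he : -(a + b) ≤ e) :
    ∃ x y : ℝ, x + y = e ∧ -a ≤ x ∧ -b ≤ y ∧ |x| ≤ |e| ∧ |y| ≤ |e| := by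
  rcases le_total (-a) e with h | h
  · exact ⟨e, 0, by simp, h, by simpa using hb, le_rfl, by simp⟩
  · refine ⟨-a, e + a, by ring, le_rfl, by linarith, ?_, ?_⟩
    · rw [abs_of_nonpos (by linarith : e ≤ 0), abs_neg, abs_of_nonneg ha]
      linarith
    · rw [abs_of_nonpos (by linarith : e ≤ 0), abs_of_nonpos (by linarith)]
      linarith


/-- Quartic Bernstein construction: under `λ|b - a| ≤ a + b` and
`|c - (a+b)/2| ≤ (λ/4)|b - a|`, there exist `m₁, m₂ ≥ 0` close to `a, b` such that
integrating the cubic Bernstein velocity `a B₀₃ + 3m₁·(τ(1-τ)²)·… ` yields a monotone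
Hermite interpolant with `|G''| ≤ 3(2λ+1)|b - a|` on `[0,1]`. -/
theorem bernstein_quartic_interpolant
    (a b c lam : ℝ) (ha : 0 ≤ a) (hb : 0 ≤ b) (hc : 0 ≤ c) (hlam : 0 < lam)
    (hlam2 : lam * |b - a| ≤ a + b)
    (hcrange : |c - (a + b) / 2| ≤ lam / 4 * |b - a|) :
    ∃ m₁ m₂ : ℝ, 0 ≤ m₁ ∧ 0 ≤ m₂ ∧
      |m₁ - a| ≤ lam * |b - a| ∧ |m₂ - b| ≤ lam * |b - a| ∧
      ∀ G : ℝ → ℝ,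
        (∀ t, G t = ∫ τ in (0:ℝ)..t,
            a * (1 - τ) ^ 3 + 3 * m₁ * (τ * (1 - τ) ^ 2)
              + 3 * m₂ * (τ ^ 2 * (1 - τ)) + b * τ ^ 3) →
        G 0 = 0 ∧ G 1 = c ∧ deriv G 0 = a ∧ deriv G 1 = b ∧
        (∀ t ∈ Set.Icc (0:ℝ) 1, 0 ≤ deriv G t) ∧
        (∀ t ∈ Set.Icc (0:ℝ) 1,
          |deriv (deriv G) t| ≤ 3 * (2 * lam + 1) * |b - a|) := by
  have he : |4 * c - 2 * (a + b)| ≤ lam * |b - a| := by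
    rw [abs_le] at hcrange ⊢
    constructor <;> linarith
  obtain ⟨x, y, hxy, hxa, hyb, hx, hy⟩ := exists_add_eq_of_neg_add_le (e := 4 * c - 2 * (a + b))
    ha hb (by linarith [(abs_le.1 he).1])
  replace hx := hx.trans he
  replace hy := hy.trans he
  have hm₁ : 0 ≤ a + x := by linarith
  have hm₂ : 0 ≤ b + y := by linarith
  refine ⟨a + x, b + y, hm₁, hm₂, by simpa using hx, by simpa using hy, fun G hG ↦ ?_⟩
  replace hG : G = fun t ↦ ∫ τ in (0 : ℝ)..t, bernsteinCubic a (a + x) (b + y) b τ := funext hG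
  have hderiv : deriv G = bernsteinCubic a (a + x) (b + y) b := by
    funext t
    rw [hG]
    exact (continuous_bernsteinCubic a (a + x) (b + y) b).deriv_integral _ 0 t
  rw [hderiv]
  refine ⟨by simp [hG], ?_, by simp [bernsteinCubic], by simp [bernsteinCubic],
    fun t ht ↦ bernsteinCubic_nonneg ha hm₁ hm₂ hb ht, fun t ht ↦ ?_⟩
  · rw [hG]
    simp only [integral_bernsteinCubic]
    linarith
  · have hlam_nonneg : 0 ≤ lam * |b - a| := by positivity
    have hd := abs_nonneg (b - a)
    rw [mul_assoc]
    apply abs_deriv_bernsteinCubic_le _ _ _ ht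
    · rw [add_sub_cancel_left]
      linarith
    · rw [show b + y - (a + x) = (b - a) + y - x by ring]
      linarith [abs_sub (b - a + y) x, abs_add_le (b - a) y]
    · rw [sub_add_cancel_left, abs_neg]
      linarith
end
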